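/- For every n ∈ ℕ, every uniformly complete Archimedean f-algebra A, and every a₁, …, aₙ ∈ A, there exists a unique lattice-algebra homomorphism Ψ : PG_n^h → A with Ψ(πᵢ) = aᵢ for i = 1, …, n. (Equivalently: PG_n^h, together with the map i ↦ πᵢ, is the free uniformly complete f-algebra over {1, …, n}.) -/

import Mathlib

open scoped BigOperators

/-- A continuous function `ℝⁿ → ℝ` of polynomial growth (an element of `PG_n`). -/
def PolyGrowth (n : ℕ) (f : (Fin n → ℝ) → ℝ) : Prop :=
  Continuous f ∧ ∃ (M : ℝ) (N : ℕ), 0 ≤ M ∧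
    ∀ t : Fin n → ℝ, |f t| ≤ M * (1 + ∑ i : Fin n, |t i|) ^ N

/-- An element of `PG_n^h`: a polynomial growth continuous function `f` such that
`f (t • x) / t` converges as `t → 0⁺`, uniformly in `x` on every bounded set. -/
def PolyGrowthH (n : ℕ) (f : (Fin n → ℝ) → ℝ) : Prop :=
  PolyGrowth n f ∧ ∃ fh : (Fin n → ℝ) → ℝ,
    ∀ B : Set (Fin n → ℝ), Bornology.IsBounded B →
      ∀ ε : ℝ, 0 < ε → ∃ δ : ℝ, 0 < δ ∧
        ∀ t : ℝ, 0 < t → t < δ → ∀ y ∈ B, |f (t • y) / t - fh y| < ε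

/-- An element of `H_n`: a continuous positively homogeneous function `ℝⁿ → ℝ`. -/
def PosHomog (n : ℕ) (f : (Fin n → ℝ) → ℝ) : Prop :=
  Continuous f ∧ ∀ (c : ℝ), 0 ≤ c → ∀ t : Fin n → ℝ, f (c • t) = c * f t

section Defs

variable {X : Type*} [Lattice X] [AddCommGroup X] [Module ℝ X]

/-- The order ideal `I_e` generated by `e`. -/
def idealSet (e : X) : Set X := {x : X | ∃ c : ℝ, 0 ≤ c ∧ |x| ≤ c • e}

/-- The norm `‖x‖_e = inf {c ≥ 0 : |x| ≤ c • e}`. -/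
noncomputable def regNorm (e x : X) : ℝ := sInf {c : ℝ | 0 ≤ c ∧ |x| ≤ c • e}

/-- The norm `‖·‖_e` is complete on the set `S`: every `‖·‖_e`-Cauchy sequence in `S`
converges, in `‖·‖_e`, to an element of `S`. -/
def NormComplete (e : X) (S : Set X) : Prop :=
  ∀ u : ℕ → X, (∀ k, u k ∈ S) →
    (∀ ε : ℝ, 0 < ε → ∃ N : ℕ, ∀ p q : ℕ, N ≤ p → N ≤ q → regNorm e (u p - u q) < ε) →
    ∃ x ∈ S, ∀ ε : ℝ, 0 < ε → ∃ N : ℕ, ∀ p : ℕ, N ≤ p → regNorm e (u p - x) < ε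

/-- A uniformly complete vector lattice: `(I_e, ‖·‖_e)` is complete for every `e ≥ 0`. -/
def UniformlyComplete (X : Type*) [Lattice X] [AddCommGroup X] [Module ℝ X] : Prop :=
  ∀ e : X, 0 ≤ e → NormComplete e (idealSet e)

/-- A subset `Z` is uniformly complete as a vector lattice in its own right. -/
def UCSet (Z : Set X) : Prop :=
  ∀ e ∈ Z, 0 ≤ e → NormComplete e (Z ∩ idealSet e)

/-- A (vector) sublattice: a linear subspace closed under binary suprema. -/
def IsSublatticeSet (Z : Set X) : Prop :=
  (0 ∈ Z) ∧ (∀ a ∈ Z, ∀ b ∈ Z, a + b ∈ Z) ∧ (∀ (c : ℝ), ∀ a ∈ Z, c • a ∈ Z) ∧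
  (∀ a ∈ Z, -a ∈ Z) ∧ (∀ a ∈ Z, ∀ b ∈ Z, a ⊔ b ∈ Z) ∧ (∀ a ∈ Z, ∀ b ∈ Z, a ⊓ b ∈ Z)

/-- An order ideal: a linear subspace that is solid. -/
def IsOrderIdealSet (I : Set X) : Prop :=
  (0 ∈ I) ∧ (∀ a ∈ I, ∀ b ∈ I, a + b ∈ I) ∧ (∀ (c : ℝ), ∀ a ∈ I, c • a ∈ I) ∧
  (∀ a ∈ I, ∀ b : X, |b| ≤ |a| → b ∈ I)

/-- A vector lattice homomorphism defined on the class of functions `ℝⁿ → ℝ`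
satisfying the predicate `P` (with pointwise operations), taking values in `X`. -/
def IsLatHom {n : ℕ} (P : ((Fin n → ℝ) → ℝ) → Prop) (Φ : ∀ f, P f → X) : Prop :=
  (∀ (f g : (Fin n → ℝ) → ℝ) (hf : P f) (hg : P g) (hfg : P (f + g)),
      Φ (f + g) hfg = Φ f hf + Φ g hg) ∧
  (∀ (c : ℝ) (f : (Fin n → ℝ) → ℝ) (hf : P f) (hcf : P (c • f)),
      Φ (c • f) hcf = c • Φ f hf) ∧
  (∀ (f g : (Fin n → ℝ) → ℝ) (hf : P f) (hg : P g) (hfg : P (f ⊔ g)),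
      Φ (f ⊔ g) hfg = Φ f hf ⊔ Φ g hg)

end Defs

section MulDefs

variable {X : Type*} [Lattice X] [AddCommGroup X] [Module ℝ X] [Mul X]

/-- A lattice-algebra homomorphism defined on the class of functions `ℝⁿ → ℝ`
satisfying the predicate `P` (with pointwise operations), taking values in `X`. -/
def IsLatAlgHom {n : ℕ} (P : ((Fin n → ℝ) → ℝ) → Prop) (Ψ : ∀ f, P f → X) : Prop :=
  IsLatHom P Ψ ∧
  (∀ (f g : (Fin n → ℝ) → ℝ) (hf : P f) (hg : P g) (hfg : P (f * g)),
      Ψ (f * g) hfg = Ψ f hf * Ψ g hg)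

/-- A sublattice-algebra: a linear subspace that is both a sublattice and a subalgebra. -/
def IsSublatticeAlgebraSet (Z : Set X) : Prop :=
  IsSublatticeSet Z ∧ ∀ a ∈ Z, ∀ b ∈ Z, a * b ∈ Z

/-- The `f`-algebra condition, relativized to a subset. -/
def IsFAlgebraSet (Z : Set X) : Prop :=
  ∀ a ∈ Z, ∀ b ∈ Z, ∀ z ∈ Z, a ⊓ b = 0 → 0 ≤ z → (z * a) ⊓ b = 0 ∧ (a * z) ⊓ b = 0

/-- An `f`-subalgebra: a sublattice-algebra which is itself an `f`-algebra. -/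
def IsFSubalgebra (Z : Set X) : Prop := IsSublatticeAlgebraSet Z ∧ IsFAlgebraSet Z

/-- `powS e m = e^(m+1)`, defined without assuming an identity element. -/
def powS (e : X) : ℕ → X
  | 0 => e
  | m + 1 => powS e m * e

end MulDefs

/-- A map `T : X → A` which is a lattice-algebra homomorphism on a subset `S` of `X`. -/
def IsLatAlgHomOn {X A : Type*} [Lattice X] [AddCommGroup X] [Module ℝ X] [Mul X]
    [Lattice A] [AddCommGroup A] [Module ℝ A] [Mul A] (S : Set X) (T : X → A) : Prop :=
  (∀ a ∈ S, ∀ b ∈ S, T (a + b) = T a + T b) ∧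
  (∀ (c : ℝ), ∀ a ∈ S, T (c • a) = c • T a) ∧
  (∀ a ∈ S, ∀ b ∈ S, T (a ⊔ b) = T a ⊔ T b) ∧
  (∀ a ∈ S, ∀ b ∈ S, T (a * b) = T a * T b)

open Set Filter Topology

set_option linter.unusedSectionVars false

section LatticeModule

variable {A : Type*} [Lattice A] [AddCommGroup A] [IsOrderedAddMonoid A]

theorem abs_sup_sub_sup_le (x y z w : A) : |x ⊔ y - z ⊔ w| ≤ |x - z| + |y - w| := by
  calc |x ⊔ y - z ⊔ w| = |(x ⊔ y - z ⊔ y) + (y ⊔ z - w ⊔ z)| := by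
        rw [sup_comm y z, sup_comm w z]; congr 1; abel
    _ ≤ |x ⊔ y - z ⊔ y| + |y ⊔ z - w ⊔ z| := abs_add_le _ _
    _ ≤ |x - z| + |y - w| := add_le_add (abs_sup_sub_sup_le_abs _ _ _) (abs_sup_sub_sup_le_abs _ _ _)

theorem inf_add_eq_zero {t x y : A} (hx : 0 ≤ x) (hy : 0 ≤ y)
    (htx : t ⊓ x = 0) (hty : t ⊓ y = 0) : t ⊓ (x + y) = 0 := by
  have ht : 0 ≤ t := htx ▸ inf_le_left
  refine le_antisymm ?_ (le_inf ht (add_nonneg hx hy))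
  have h1 : t ⊓ (x + y) - y ≤ t ⊓ x :=
    le_inf ((sub_le_self _ hy).trans inf_le_left) (sub_le_iff_le_add.2 inf_le_right)
  rw [htx, sub_nonpos] at h1
  exact (le_inf inf_le_left h1).trans hty.le

variable [Module ℝ A] [IsOrderedModule ℝ A]

theorem sup_smul_of_nonneg {w : A} (hw : 0 ≤ w) (c d : ℝ) : (c ⊔ d) • w = c • w ⊔ d • w := by
  rcases le_total c d with h | h
  · rw [sup_eq_right.2 h, sup_eq_right.2 (smul_le_smul_of_nonneg_right h hw)]
  · rw [sup_eq_left.2 h, sup_eq_left.2 (smul_le_smul_of_nonneg_right h hw)]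

theorem abs_smul_le_smul_abs (c : ℝ) (x : A) : |c • x| ≤ |c| • |x| := by
  have key : ∀ (d : ℝ) (y : A), d • y ≤ |d| • |y| := fun d y => by
    have h1 : 0 ≤ (|d| - d) • (|y| + y) :=
      smul_nonneg (sub_nonneg.2 (le_abs_self d)) (neg_le_iff_add_nonneg.1 (neg_le_abs y))
    have h2 : 0 ≤ (|d| + d) • (|y| - y) :=
      smul_nonneg (neg_le_iff_add_nonneg.1 (neg_abs_le d) |>.trans_eq (add_comm _ _))
        (sub_nonneg.2 (le_abs_self y))
    have h3 : 0 ≤ (2⁻¹ : ℝ) • ((|d| - d) • (|y| + y) + (|d| + d) • (|y| - y)) :=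
      smul_nonneg (by norm_num) (add_nonneg h1 h2)
    rw [← sub_nonneg]
    convert h3 using 1
    module
  refine abs_le'.2 ⟨key c x, ?_⟩
  rw [← neg_smul, ← abs_neg c]
  exact key _ _

end LatticeModule

section LatticeAlgebra

variable {A : Type*} [Lattice A] [NonUnitalRing A] [IsOrderedAddMonoid A]
  [PosMulMono A] [MulPosMono A] [Module ℝ A] [IsOrderedModule ℝ A]

theorem abs_mul_le_mul_abs (x y : A) : |x * y| ≤ |x| * |y| := by
  have key : ∀ u v : A, u * v ≤ |u| * |v| := fun u v => by
    have h1 : 0 ≤ (|u| - u) * (|v| + v) :=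
      mul_nonneg (sub_nonneg.2 (le_abs_self u)) (neg_le_iff_add_nonneg.1 (neg_le_abs v))
    have h2 : 0 ≤ (|u| + u) * (|v| - v) :=
      mul_nonneg (neg_le_iff_add_nonneg.1 (neg_le_abs u)) (sub_nonneg.2 (le_abs_self v))
    have h3 : 0 ≤ (2⁻¹ : ℝ) • ((|u| - u) * (|v| + v) + (|u| + u) * (|v| - v)) :=
      smul_nonneg (by norm_num) (add_nonneg h1 h2)
    rw [← sub_nonneg]
    convert h3 using 1
    simp only [sub_mul, add_mul, mul_add, mul_sub]
    module
  refine abs_le'.2 ⟨key x y, ?_⟩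
  rw [← neg_mul, ← abs_neg x]
  exact key _ _

/-- A prime order ideal that is also a two-sided ring ideal. -/
structure IsPrimeLatticeIdeal (P : Set A) : Prop where
  zero_mem : (0 : A) ∈ P
  add_mem : ∀ {x y}, x ∈ P → y ∈ P → x + y ∈ P
  solid : ∀ {x y}, |x| ≤ |y| → y ∈ P → x ∈ P
  mul_mem_left : ∀ (z : A) {x}, x ∈ P → z * x ∈ P
  mul_mem_right : ∀ (z : A) {x}, x ∈ P → x * z ∈ P
  mem_or_mem : ∀ {x y}, x ⊓ y = 0 → x ∈ P ∨ y ∈ P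

namespace IsPrimeLatticeIdeal

variable {P : Set A}

theorem nsmul_mem (hP : IsPrimeLatticeIdeal P) (k : ℕ) {x : A} (hx : x ∈ P) : k • x ∈ P := by
  induction k with
  | zero => simpa using hP.zero_mem
  | succ k ih => rw [succ_nsmul]; exact hP.add_mem ih hx

theorem mem_of_nonneg_of_le (hP : IsPrimeLatticeIdeal P) {x y : A} (hx : 0 ≤ x) (hxy : x ≤ y)
    (hy : y ∈ P) : x ∈ P :=
  hP.solid (by rwa [abs_of_nonneg hx, abs_of_nonneg (hx.trans hxy)]) hy

theorem abs_mem (hP : IsPrimeLatticeIdeal P) {x : A} (hx : x ∈ P) : |x| ∈ P :=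
  hP.solid (abs_abs x).le hx

theorem smul_mem (hP : IsPrimeLatticeIdeal P) (c : ℝ) {x : A} (hx : x ∈ P) : c • x ∈ P := by
  obtain ⟨k, hk⟩ := exists_nat_ge |c|
  refine hP.solid ?_ (hP.nsmul_mem k (hP.abs_mem hx))
  calc |c • x| ≤ |c| • |x| := abs_smul_le_smul_abs c x
    _ ≤ (k : ℝ) • |x| := smul_le_smul_of_nonneg_right hk (abs_nonneg x)
    _ = k • |x| := Nat.cast_smul_eq_nsmul ℝ k _
    _ ≤ abs (k • |x|) := le_abs_self _

theorem le_or_le (hP : IsPrimeLatticeIdeal P) (x y : A) :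
    (∃ p ∈ P, x ≤ y + p) ∨ ∃ p ∈ P, y ≤ x + p := by
  rcases hP.mem_or_mem (posPart_inf_negPart_eq_zero (x - y)) with h | h
  · exact .inl ⟨_, h, by rw [← sub_le_iff_le_add']; exact le_posPart _⟩
  · exact .inr ⟨_, h, by rw [← sub_le_iff_le_add', ← neg_sub]; exact neg_le_negPart _⟩

end IsPrimeLatticeIdeal

/-- In an `f`-algebra, every nonzero positive element is avoided by a prime ideal. -/
theorem exists_isPrimeLatticeIdeal_notMem
    (hfalg : ∀ a b z : A, a ⊓ b = 0 → 0 ≤ z → (z * a) ⊓ b = 0 ∧ (a * z) ⊓ b = 0)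
    {y : A} (hy : 0 ≤ y) (hy0 : y ≠ 0) : ∃ P : Set A, IsPrimeLatticeIdeal P ∧ y ∉ P := by
  let S : Set (Set A) := {F | (∀ u ∈ F, 0 ≤ u) ∧ (∀ u ∈ F, ∀ v ∈ F, u ⊓ v ∈ F) ∧ (0 : A) ∉ F}
  obtain ⟨F, hyF, hF⟩ := zorn_subset_nonempty S (fun c hcS hc _ => by
    refine ⟨⋃₀ c, ⟨?_, ?_, ?_⟩, fun s hs => subset_sUnion_of_mem hs⟩
    · rintro u ⟨s, hs, hu⟩
      exact (hcS hs).1 u hu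
    · rintro u ⟨s, hs, hu⟩ v ⟨t, ht, hv⟩
      rcases hc.total hs ht with h | h
      · exact ⟨t, ht, (hcS ht).2.1 u (h hu) v hv⟩
      · exact ⟨s, hs, (hcS hs).2.1 u hu v (h hv)⟩
    · rintro ⟨s, hs, h0⟩
      exact (hcS hs).2.2 h0) {y}
    ⟨by simpa using hy, by simp, by simpa using hy0.symm⟩
  obtain ⟨⟨hF0, hFinf, h0F⟩, hmax⟩ := hF
  rw [singleton_subset_iff] at hyF
  have mono : ∀ {u x z : A}, 0 ≤ u → |x| ≤ |z| → u ⊓ |z| = 0 → u ⊓ |x| = 0 :=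
    fun hu hxz h => le_antisymm ((inf_le_inf_left _ hxz).trans h.le) (le_inf hu (abs_nonneg _))
  refine ⟨{p | ∃ u ∈ F, u ⊓ |p| = 0}, ⟨⟨y, hyF, by simpa using hy⟩, ?_, ?_, ?_, ?_, ?_⟩, ?_⟩
  · rintro p q ⟨u, hu, hup⟩ ⟨v, hv, hvq⟩
    have huv := hFinf u hu v hv
    have h0 := hF0 _ huv
    refine ⟨u ⊓ v, huv, mono h0 ((abs_add_le p q).trans (le_abs_self _)) ?_⟩
    rw [abs_of_nonneg (add_nonneg (abs_nonneg p) (abs_nonneg q))]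
    refine inf_add_eq_zero (abs_nonneg p) (abs_nonneg q) ?_ ?_
    · exact le_antisymm ((inf_le_inf_right _ inf_le_left).trans hup.le) (le_inf h0 (abs_nonneg p))
    · exact le_antisymm ((inf_le_inf_right _ inf_le_right).trans hvq.le) (le_inf h0 (abs_nonneg q))
  · rintro p q hpq ⟨u, hu, huq⟩
    exact ⟨u, hu, mono (hF0 u hu) hpq huq⟩
  · rintro z p ⟨u, hu, hup⟩
    refine ⟨u, hu, mono (hF0 u hu) ((abs_mul_le_mul_abs z p).trans (le_abs_self _)) ?_⟩
    rw [abs_of_nonneg (mul_nonneg (abs_nonneg z) (abs_nonneg p)), inf_comm]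
    exact (hfalg _ _ _ (by rwa [inf_comm]) (abs_nonneg z)).1
  · rintro z p ⟨u, hu, hup⟩
    refine ⟨u, hu, mono (hF0 u hu) ((abs_mul_le_mul_abs p z).trans (le_abs_self _)) ?_⟩
    rw [abs_of_nonneg (mul_nonneg (abs_nonneg p) (abs_nonneg z)), inf_comm]
    exact (hfalg _ _ _ (by rwa [inf_comm]) (abs_nonneg z)).2
  · intro u v huv
    have hu0 : 0 ≤ u := huv ▸ inf_le_left
    have hv0 : 0 ≤ v := huv ▸ inf_le_right
    by_cases huF : u ∈ F
    · exact .inr ⟨u, huF, by rwa [abs_of_nonneg hv0]⟩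
    refine .inl ?_
    by_contra hcon
    have hG : {z | 0 ≤ z ∧ ∃ f ∈ F, f ⊓ u ≤ z} ∈ S := by
      refine ⟨fun z hz => hz.1, ?_, ?_⟩
      · rintro z ⟨hz, f, hf, hfz⟩ w ⟨hw, g, hg, hgw⟩
        exact ⟨le_inf hz hw, f ⊓ g, hFinf f hf g hg, le_inf
          ((inf_le_inf_right _ inf_le_left).trans hfz) ((inf_le_inf_right _ inf_le_right).trans hgw)⟩
      · rintro ⟨-, f, hf, hfu⟩
        exact hcon ⟨f, hf, by
          rw [abs_of_nonneg hu0]; exact le_antisymm hfu (le_inf (hF0 f hf) hu0)⟩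
    exact huF (hmax hG (fun f hf => ⟨hF0 f hf, f, hf, inf_le_left⟩) ⟨hu0, y, hyF, inf_le_right⟩)
  · rintro ⟨u, hu, huy⟩
    rw [abs_of_nonneg hy] at huy
    exact h0F (huy ▸ hFinf u hu y hyF)

/-- Modulo `P`, the element `z` differs from `c • w` by an infinitesimal relative to `w`. -/
def IsInfinitesimallyNear (P : Set A) (w z : A) (c : ℝ) : Prop :=
  ∀ ε : ℝ, 0 < ε → ∃ p ∈ P, |z - c • w| ≤ ε • w + p

namespace IsInfinitesimallyNear

variable {P : Set A} {w w' z z' : A} {c c' : ℝ}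

theorem zero (hP : IsPrimeLatticeIdeal P) (hw : 0 ≤ w) : IsInfinitesimallyNear P w 0 0 :=
  fun ε hε => ⟨0, hP.zero_mem, by simpa using smul_nonneg hε.le hw⟩

theorem add (hP : IsPrimeLatticeIdeal P) (h : IsInfinitesimallyNear P w z c)
    (h' : IsInfinitesimallyNear P w z' c') : IsInfinitesimallyNear P w (z + z') (c + c') := by
  intro ε hε
  obtain ⟨p, hp, h⟩ := h (ε / 2) (half_pos hε)
  obtain ⟨p', hp', h'⟩ := h' (ε / 2) (half_pos hε)
  refine ⟨p + p', hP.add_mem hp hp', ?_⟩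
  calc |z + z' - (c + c') • w| = |(z - c • w) + (z' - c' • w)| := by congr 1; module
    _ ≤ |z - c • w| + |z' - c' • w| := abs_add_le _ _
    _ ≤ ((ε / 2) • w + p) + ((ε / 2) • w + p') := add_le_add h h'
    _ = ε • w + (p + p') := by module

theorem sup (hP : IsPrimeLatticeIdeal P) (hw : 0 ≤ w) (h : IsInfinitesimallyNear P w z c)
    (h' : IsInfinitesimallyNear P w z' c') : IsInfinitesimallyNear P w (z ⊔ z') (c ⊔ c') := by
  intro ε hε
  obtain ⟨p, hp, h⟩ := h (ε / 2) (half_pos hε)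
  obtain ⟨p', hp', h'⟩ := h' (ε / 2) (half_pos hε)
  refine ⟨p + p', hP.add_mem hp hp', ?_⟩
  rw [sup_smul_of_nonneg hw]
  calc |z ⊔ z' - c • w ⊔ c' • w| ≤ |z - c • w| + |z' - c' • w| := abs_sup_sub_sup_le _ _ _ _
    _ ≤ ((ε / 2) • w + p) + ((ε / 2) • w + p') := add_le_add h h'
    _ = ε • w + (p + p') := by module

theorem smul (hP : IsPrimeLatticeIdeal P) (hw : 0 ≤ w) (d : ℝ)
    (h : IsInfinitesimallyNear P w z c) : IsInfinitesimallyNear P w (d • z) (d * c) := by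
  intro ε hε
  have hd : 0 < |d| + 1 := by positivity
  obtain ⟨p, hp, h⟩ := h (ε / (|d| + 1)) (by positivity)
  refine ⟨|d| • p, hP.smul_mem _ hp, ?_⟩
  calc |d • z - (d * c) • w| = |d • (z - c • w)| := by congr 1; module
    _ ≤ |d| • |z - c • w| := abs_smul_le_smul_abs _ _
    _ ≤ |d| • ((ε / (|d| + 1)) • w + p) := smul_le_smul_of_nonneg_left h (abs_nonneg d)
    _ = (|d| * (ε / (|d| + 1))) • w + |d| • p := by module
    _ ≤ ε • w + |d| • p := by
      gcongr
      rw [mul_div_assoc', div_le_iff₀ hd]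
      nlinarith

theorem abs_le (h : IsInfinitesimallyNear P w z c) (hw : 0 ≤ w) :
    ∃ p ∈ P, |z| ≤ (|c| + 1) • w + p := by
  obtain ⟨p, hp, h⟩ := h 1 one_pos
  refine ⟨p, hp, ?_⟩
  calc |z| = |c • w + (z - c • w)| := by congr 1; abel
    _ ≤ |c • w| + |z - c • w| := abs_add_le _ _
    _ ≤ |c| • |w| + ((1 : ℝ) • w + p) := add_le_add (abs_smul_le_smul_abs _ _) h
    _ = (|c| + 1) • w + p := by rw [abs_of_nonneg hw]; module

theorem trans (hP : IsPrimeLatticeIdeal P) (hw' : 0 ≤ w')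
    (h : IsInfinitesimallyNear P w z c) (hw : IsInfinitesimallyNear P w' w c') (hw0 : 0 ≤ w) :
    IsInfinitesimallyNear P w' z (c * c') := by
  intro ε hε
  obtain ⟨q, hq, hwq⟩ := hw.abs_le hw'
  rw [abs_of_nonneg hw0] at hwq
  have h1 : 0 < |c'| + 1 := by positivity
  have h2 : 0 < |c| + 1 := by positivity
  set δ := ε / 2 / (|c'| + 1) with hδ
  set η := ε / 2 / (|c| + 1) with hη
  obtain ⟨p, hp, h⟩ := h δ (by positivity)
  obtain ⟨p', hp', hw⟩ := hw η (by positivity)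
  refine ⟨δ • q + p + |c| • p',
    hP.add_mem (hP.add_mem (hP.smul_mem _ hq) hp) (hP.smul_mem _ hp'), ?_⟩
  calc |z - (c * c') • w'| = |(z - c • w) + c • (w - c' • w')| := by congr 1; module
    _ ≤ |z - c • w| + |c • (w - c' • w')| := abs_add_le _ _
    _ ≤ |z - c • w| + |c| • |w - c' • w'| := add_le_add le_rfl (abs_smul_le_smul_abs _ _)
    _ ≤ (δ • ((|c'| + 1) • w' + q) + p) + |c| • (η • w' + p') := by
      refine add_le_add (h.trans ?_) (smul_le_smul_of_nonneg_left hw (abs_nonneg c))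
      have : 0 ≤ δ := by positivity
      gcongr
    _ = (δ * (|c'| + 1) + |c| * η) • w' + (δ • q + p + |c| • p') := by module
    _ ≤ ε • w' + (δ • q + p + |c| • p') := by
      gcongr
      have e1 : δ * (|c'| + 1) = ε / 2 := by rw [hδ]; field_simp
      have e2 : (|c| + 1) * η = ε / 2 := by rw [hη]; field_simp
      have : 0 < η := by positivity
      nlinarith

section Mul

variable [IsScalarTower ℝ A A] [SMulCommClass ℝ A A]

theorem mul (hP : IsPrimeLatticeIdeal P) (hw : 0 ≤ w) (hw' : 0 ≤ w')
    (h : IsInfinitesimallyNear P w z c) (h' : IsInfinitesimallyNear P w' z' c') :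
    IsInfinitesimallyNear P (w * w') (z * z') (c * c') := by
  intro ε hε
  obtain ⟨q, hq, hzq⟩ := h'.abs_le hw'
  have h1 : 0 < |c'| + 1 := by positivity
  have h2 : 0 < |c| + 1 := by positivity
  set δ := ε / 2 / (|c'| + 1) with hδ
  set η := ε / 2 / (|c| + 1) with hη
  obtain ⟨p, hp, h⟩ := h δ (by positivity)
  obtain ⟨p', hp', h'⟩ := h' η (by positivity)
  refine ⟨δ • (w * q) + p * ((|c'| + 1) • w' + q) + |c| • (w * p'),
    hP.add_mem (hP.add_mem (hP.smul_mem _ (hP.mul_mem_left _ hq)) (hP.mul_mem_right _ hp))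
      (hP.smul_mem _ (hP.mul_mem_left _ hp')), ?_⟩
  have hηpos : 0 < η := by positivity
  calc |z * z' - (c * c') • (w * w')|
      = |(z - c • w) * z' + (c • w) * (z' - c' • w')| := by
        congr 1
        simp only [sub_mul, mul_sub, smul_mul_assoc, mul_smul_comm]
        module
    _ ≤ |(z - c • w) * z'| + |(c • w) * (z' - c' • w')| := abs_add_le _ _
    _ ≤ |z - c • w| * |z'| + |c • w| * |z' - c' • w'| :=
        add_le_add (abs_mul_le_mul_abs _ _) (abs_mul_le_mul_abs _ _)
    _ ≤ (δ • w + p) * ((|c'| + 1) • w' + q) + (|c| • w) * (η • w' + p') := by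
        refine add_le_add (mul_le_mul h hzq (abs_nonneg _) ((abs_nonneg _).trans h))
          (mul_le_mul ?_ h' (abs_nonneg _) (smul_nonneg (abs_nonneg c) hw))
        simpa only [abs_of_nonneg hw] using abs_smul_le_smul_abs c w
    _ = (δ * (|c'| + 1) + |c| * η) • (w * w')
        + (δ • (w * q) + p * ((|c'| + 1) • w' + q) + |c| • (w * p')) := by
        simp only [add_mul, mul_add, smul_mul_assoc, mul_smul_comm]
        module
    _ ≤ ε • (w * w') + (δ • (w * q) + p * ((|c'| + 1) • w' + q) + |c| • (w * p')) := by
      have := mul_nonneg hw hw'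
      gcongr
      have e1 : δ * (|c'| + 1) = ε / 2 := by rw [hδ]; field_simp
      have e2 : (|c| + 1) * η = ε / 2 := by rw [hη]; field_simp
      nlinarith

theorem add_mul_self (hP : IsPrimeLatticeIdeal P) {e : A} (he : 0 ≤ e)
    (h : IsInfinitesimallyNear P w z c) :
    IsInfinitesimallyNear P (w + w * e) (z + z * e) c := by
  intro ε hε
  obtain ⟨p, hp, h⟩ := h ε hε
  refine ⟨p + p * e, hP.add_mem hp (hP.mul_mem_right _ hp), ?_⟩
  calc |z + z * e - c • (w + w * e)| = |(z - c • w) + (z - c • w) * e| := by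
        congr 1
        simp only [sub_mul, smul_mul_assoc]
        module
    _ ≤ |z - c • w| + |z - c • w| * e :=
        (abs_add_le _ _).trans (add_le_add le_rfl ((abs_mul_le_mul_abs _ _).trans_eq
          (by rw [abs_of_nonneg he])))
    _ ≤ (ε • w + p) + (ε • w + p) * e := add_le_add h (mul_le_mul_of_nonneg_right h he)
    _ = ε • (w + w * e) + (p + p * e) := by
        simp only [add_mul, smul_mul_assoc]
        module

end Mul

end IsInfinitesimallyNear

theorem IsPrimeLatticeIdeal.exists_isInfinitesimallyNear {P : Set A} (hP : IsPrimeLatticeIdeal P)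
    {w z : A} (hw : 0 ≤ w) {r s : ℝ} (hrs : r ≤ s) (hr : r • w ≤ z) (hs : z ≤ s • w) :
    ∃ c ∈ Icc r s, IsInfinitesimallyNear P w z c := by
  let S : Set ℝ := {t | t ∈ Icc r s ∧ ∃ p ∈ P, t • w ≤ z + p}
  have hrS : r ∈ S := ⟨⟨le_rfl, hrs⟩, 0, hP.zero_mem, by simpa using hr⟩
  have hSb : BddAbove S := ⟨s, fun t ht => ht.1.2⟩
  have hc : r ≤ sSup S := le_csSup hSb hrS
  have hc' : sSup S ≤ s := csSup_le ⟨r, hrS⟩ fun t ht => ht.1.2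
  refine ⟨sSup S, ⟨hc, hc'⟩, fun ε hε => ?_⟩
  obtain ⟨t, ⟨-, p, hp, htz⟩, ht⟩ := exists_lt_of_lt_csSup ⟨r, hrS⟩ (sub_lt_self (sSup S) hε)
  have upper : ∃ q ∈ P, z ≤ (sSup S + ε) • w + q := by
    rcases le_or_gt (sSup S + ε) s with h | h
    · rcases hP.le_or_le z ((sSup S + ε) • w) with h' | h'
      · exact h'
      · have : sSup S + ε ∈ S := ⟨⟨hc.trans (le_add_of_nonneg_right hε.le), h⟩, h'⟩
        linarith [le_csSup hSb this]
    · exact ⟨0, hP.zero_mem, by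
        rw [add_zero]; exact hs.trans (smul_le_smul_of_nonneg_right h.le hw)⟩
  obtain ⟨q, hq, hzq⟩ := upper
  refine ⟨|p| + |q|, hP.add_mem (hP.abs_mem hp) (hP.abs_mem hq), abs_le'.2 ⟨?_, ?_⟩⟩
  · calc z - sSup S • w ≤ (sSup S + ε) • w + q - sSup S • w := sub_le_sub_right hzq _
      _ = ε • w + (0 + q) := by module
      _ ≤ ε • w + (|p| + |q|) := by
        gcongr
        exacts [abs_nonneg p, le_abs_self q]
  · calc -(z - sSup S • w) ≤ sSup S • w - (t • w - p) := by
          rw [neg_sub]; exact sub_le_sub_left (sub_le_iff_le_add.2 htz) _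
      _ = (sSup S - t) • w + (p + 0) := by module
      _ ≤ ε • w + (|p| + |q|) := by
        gcongr
        exacts [by linarith, le_abs_self p, abs_nonneg q]

end LatticeAlgebra

/-- The sublattice-algebra of `ℝ^(ℝⁿ) × A` generated by the pairs `(πᵢ, aᵢ)`. -/
inductive GeneratedGraph {A : Type*} [Lattice A] [NonUnitalRing A] [Module ℝ A] {n : ℕ}
    (a : Fin n → A) : ((Fin n → ℝ) → ℝ) → A → Prop
  | zero : GeneratedGraph a 0 0
  | gen (i : Fin n) : GeneratedGraph a (fun t => t i) (a i)
  | add {f g z w} : GeneratedGraph a f z → GeneratedGraph a g w →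
      GeneratedGraph a (f + g) (z + w)
  | smul (c : ℝ) {f z} : GeneratedGraph a f z → GeneratedGraph a (c • f) (c • z)
  | sup {f g z w} : GeneratedGraph a f z → GeneratedGraph a g w →
      GeneratedGraph a (f ⊔ g) (z ⊔ w)
  | mul {f g z w} : GeneratedGraph a f z → GeneratedGraph a g w →
      GeneratedGraph a (f * g) (z * w)

/-- `growthWeight e M = e (1 + e) ^ M`, defined without assuming an identity element. -/
def growthWeight {A : Type*} [NonUnitalRing A] (e : A) : ℕ → A
  | 0 => e
  | M + 1 => growthWeight e M + growthWeight e M * e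

namespace GeneratedGraph

variable {A : Type*} [Lattice A] [NonUnitalRing A] [Module ℝ A] {n : ℕ} {a : Fin n → A}
  {f g : (Fin n → ℝ) → ℝ} {z w : A}

theorem neg (h : GeneratedGraph a f z) : GeneratedGraph a (-f) (-z) := by
  simpa using h.smul (-1)

theorem sub (hf : GeneratedGraph a f z) (hg : GeneratedGraph a g w) :
    GeneratedGraph a (f - g) (z - w) := by
  simpa [sub_eq_add_neg] using hf.add hg.neg

theorem abs (h : GeneratedGraph a f z) : GeneratedGraph a |f| |z| := h.sup h.neg

theorem sum {ι : Type*} (s : Finset ι) {F : ι → (Fin n → ℝ) → ℝ} {Z : ι → A}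
    (h : ∀ i ∈ s, GeneratedGraph a (F i) (Z i)) :
    GeneratedGraph a (∑ i ∈ s, F i) (∑ i ∈ s, Z i) := by
  classical
  induction s using Finset.induction_on with
  | empty => simpa using GeneratedGraph.zero
  | insert i s hi ih =>
    rw [Finset.sum_insert hi, Finset.sum_insert hi]
    exact (h i (Finset.mem_insert_self i s)).add
      (ih fun j hj => h j (Finset.mem_insert_of_mem hj))

theorem apply_zero (h : GeneratedGraph a f z) : f 0 = 0 := by
  induction h with
  | zero => rfl
  | gen i => rfl
  | add _ _ h1 h2 => simp [h1, h2]
  | smul c _ h => simp [h]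
  | sup _ _ h1 h2 => simp [h1, h2]
  | mul _ _ h1 h2 => simp [h1]

end GeneratedGraph

section FAlgebra

variable {A : Type*} [Lattice A] [NonUnitalRing A] [IsOrderedAddMonoid A]
  [PosMulMono A] [MulPosMono A] [Module ℝ A] [IsOrderedModule ℝ A]

theorem growthWeight_nonneg {e : A} (he : 0 ≤ e) (M : ℕ) : 0 ≤ growthWeight e M := by
  induction M with
  | zero => exact he
  | succ M ih => exact add_nonneg ih (mul_nonneg ih he)

variable [IsScalarTower ℝ A A] [SMulCommClass ℝ A A]

theorem IsInfinitesimallyNear.growthWeight_succ {P : Set A} (hP : IsPrimeLatticeIdeal P) {e : A}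
    (he : 0 ≤ e) {σ : ℝ} (hσ : IsInfinitesimallyNear P (e + e * e) e σ) (M : ℕ) :
    IsInfinitesimallyNear P (growthWeight e (M + 1)) (growthWeight e M) σ := by
  induction M with
  | zero => exact hσ
  | succ M ih => exact ih.add_mul_self hP he

theorem IsInfinitesimallyNear.growthWeight_mul {P : Set A} (hP : IsPrimeLatticeIdeal P) {e : A}
    (he : 0 ≤ e) {σ : ℝ} (hσ : IsInfinitesimallyNear P (e + e * e) (e * e) σ) (M K : ℕ) :
    IsInfinitesimallyNear P (growthWeight e (M + K + 1)) (growthWeight e M * growthWeight e K)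
      σ := by
  induction K with
  | zero =>
    induction M with
    | zero => exact hσ
    | succ M ih =>
      have h : growthWeight e (M + 1) * growthWeight e 0
          = growthWeight e M * growthWeight e 0 + growthWeight e M * growthWeight e 0 * e := by
        simp only [growthWeight, add_mul]
      rw [h]
      exact ih.add_mul_self hP he
  | succ K ih =>
    have h : growthWeight e M * growthWeight e (K + 1)
        = growthWeight e M * growthWeight e K + growthWeight e M * growthWeight e K * e := by
      simp only [growthWeight, mul_add, mul_assoc]
    rw [h]
    exact ih.add_mul_self hP he

/-- Along rays, an element of the generated graph is governed by a continuous function on the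
compactified ray, and the same function governs its values modulo prime ideals. -/
theorem GeneratedGraph.exists_asymptotics {n : ℕ} {a : Fin n → A} {f : (Fin n → ℝ) → ℝ} {z : A}
    (h : GeneratedGraph a f z) {e : A} (he : 0 ≤ e) :
    ∃ (M : ℕ) (φ : (Fin n → ℝ) → ℝ → ℝ), (∀ s, Continuous (φ s)) ∧
      (∀ s, ∀ u ∈ Ioo (0 : ℝ) 1, f ((u / (1 - u)) • s) * (1 - u) ^ (M + 1) = u * φ s u) ∧
      ∀ (P : Set A) (α : Fin n → ℝ) (σ : ℝ), IsPrimeLatticeIdeal P →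
        (∀ i, IsInfinitesimallyNear P e (a i) (α i)) →
        IsInfinitesimallyNear P (e + e * e) (e * e) σ →
        IsInfinitesimallyNear P (e + e * e) e (1 - σ) →
        IsInfinitesimallyNear P (growthWeight e M) z (φ α σ) := by
  have lift : ∀ {f : (Fin n → ℝ) → ℝ} {z : A} {M : ℕ} (K : ℕ) {φ : (Fin n → ℝ) → ℝ → ℝ},
      ((∀ s, Continuous (φ s)) ∧
      (∀ s, ∀ u ∈ Ioo (0 : ℝ) 1, f ((u / (1 - u)) • s) * (1 - u) ^ (M + 1) = u * φ s u) ∧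
      ∀ (P : Set A) (α : Fin n → ℝ) (σ : ℝ), IsPrimeLatticeIdeal P →
        (∀ i, IsInfinitesimallyNear P e (a i) (α i)) →
        IsInfinitesimallyNear P (e + e * e) (e * e) σ →
        IsInfinitesimallyNear P (e + e * e) e (1 - σ) →
        IsInfinitesimallyNear P (growthWeight e M) z (φ α σ)) →
      ∃ (φ : (Fin n → ℝ) → ℝ → ℝ), (∀ s, Continuous (φ s)) ∧
      (∀ s, ∀ u ∈ Ioo (0 : ℝ) 1, f ((u / (1 - u)) • s) * (1 - u) ^ (M + K + 1) = u * φ s u) ∧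
      ∀ (P : Set A) (α : Fin n → ℝ) (σ : ℝ), IsPrimeLatticeIdeal P →
        (∀ i, IsInfinitesimallyNear P e (a i) (α i)) →
        IsInfinitesimallyNear P (e + e * e) (e * e) σ →
        IsInfinitesimallyNear P (e + e * e) e (1 - σ) →
        IsInfinitesimallyNear P (growthWeight e (M + K)) z (φ α σ) := by
    intro f z M K φ hφ
    induction K with
    | zero => exact ⟨φ, hφ⟩
    | succ K ih =>
      obtain ⟨ψ, hc, hval, hnear⟩ := ih
      refine ⟨fun s u => ψ s u * (1 - u), fun s => (hc s).mul (by fun_prop), fun s u hu => ?_,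
        fun P α σ hP hα h1 h2 => ?_⟩
      · rw [← mul_assoc, ← hval s u hu]; ring
      · exact (hnear P α σ hP hα h1 h2).trans hP (growthWeight_nonneg he _)
          (h2.growthWeight_succ hP he _) (growthWeight_nonneg he _)
  induction h with
  | zero =>
    exact ⟨0, 0, fun s => continuous_const, by simp, fun P α σ hP _ _ _ => .zero hP he⟩
  | gen i =>
    refine ⟨0, fun s _ => s i, fun s => continuous_const, fun s u hu => ?_,
      fun P α σ hP hα _ _ => hα i⟩
    have : 1 - u ≠ 0 := by linarith [hu.2]
    simp only [Pi.smul_apply, smul_eq_mul]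
    field_simp
    ring
  | smul c _ ih =>
    obtain ⟨M, φ, hc, hval, hnear⟩ := ih
    refine ⟨M, fun s u => c * φ s u, fun s => continuous_const.mul (hc s), fun s u hu => ?_,
      fun P α σ hP hα h1 h2 => (hnear P α σ hP hα h1 h2).smul hP (growthWeight_nonneg he _) c⟩
    rw [mul_left_comm, ← hval s u hu, Pi.smul_apply, smul_eq_mul, mul_assoc]
  | add _ _ ih ih' =>
    obtain ⟨M, φ, ih⟩ := ih
    obtain ⟨K, ψ, ih'⟩ := ih'
    obtain ⟨φ, hc, hval, hnear⟩ := lift K ih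
    obtain ⟨ψ, hc', hval', hnear'⟩ := lift M ih'
    rw [add_comm K M] at hval' hnear'
    refine ⟨M + K, fun s u => φ s u + ψ s u, fun s => (hc s).add (hc' s), fun s u hu => ?_,
      fun P α σ hP hα h1 h2 => (hnear P α σ hP hα h1 h2).add hP (hnear' P α σ hP hα h1 h2)⟩
    rw [mul_add, ← hval s u hu, ← hval' s u hu, Pi.add_apply, add_mul]
  | sup _ _ ih ih' =>
    obtain ⟨M, φ, ih⟩ := ih
    obtain ⟨K, ψ, ih'⟩ := ih'
    obtain ⟨φ, hc, hval, hnear⟩ := lift K ih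
    obtain ⟨ψ, hc', hval', hnear'⟩ := lift M ih'
    rw [add_comm K M] at hval' hnear'
    refine ⟨M + K, fun s u => φ s u ⊔ ψ s u, fun s => (hc s).sup (hc' s), fun s u hu => ?_,
      fun P α σ hP hα h1 h2 => (hnear P α σ hP hα h1 h2).sup hP (growthWeight_nonneg he _)
        (hnear' P α σ hP hα h1 h2)⟩
    have hu1 : 0 ≤ (1 - u) ^ (M + K + 1) := pow_nonneg (by linarith [hu.2]) _
    rw [mul_max_of_nonneg _ _ hu.1.le, ← hval s u hu, ← hval' s u hu, Pi.sup_apply,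
      max_mul_of_nonneg _ _ hu1]
  | mul _ _ ih ih' =>
    obtain ⟨M, φ, hc, hval, hnear⟩ := ih
    obtain ⟨K, ψ, hc', hval', hnear'⟩ := ih'
    refine ⟨M + K + 1, fun s u => φ s u * ψ s u * u,
      fun s => ((hc s).mul (hc' s)).mul continuous_id, fun s u hu => ?_,
      fun P α σ hP hα h1 h2 => ?_⟩
    · rw [Pi.mul_apply, show u * (φ s u * ψ s u * u) = (u * φ s u) * (u * ψ s u) by ring,
        ← hval s u hu, ← hval' s u hu]
      ring
    · exact ((hnear P α σ hP hα h1 h2).mul hP (growthWeight_nonneg he _)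
        (growthWeight_nonneg he _) (hnear' P α σ hP hα h1 h2)).trans hP
        (growthWeight_nonneg he _) (h1.growthWeight_mul hP he _ _)
        (mul_nonneg (growthWeight_nonneg he _) (growthWeight_nonneg he _))

theorem GeneratedGraph.eq_zero
    (hfalg : ∀ a b z : A, a ⊓ b = 0 → 0 ≤ z → (z * a) ⊓ b = 0 ∧ (a * z) ⊓ b = 0)
    (harch : ∀ a b : A, 0 ≤ a → 0 ≤ b → (∀ k : ℕ, k • a ≤ b) → a = 0)
    {n : ℕ} {a : Fin n → A} {z : A} (h : GeneratedGraph a 0 z) : z = 0 := by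
  set e := ∑ i, |a i| with he_def
  have he : 0 ≤ e := Finset.sum_nonneg fun i _ => abs_nonneg _
  have hee : 0 ≤ e * e := mul_nonneg he he
  have habs : GeneratedGraph a 0 |z| := by simpa using h.abs
  obtain ⟨M, φ, hc, hval, hnear⟩ := habs.exists_asymptotics he
  have hw := growthWeight_nonneg he M
  have hz : |z| = 0 := by
    refine harch _ _ (abs_nonneg z) hw fun k => ?_
    by_contra hk
    obtain ⟨P, hP, hyP⟩ := exists_isPrimeLatticeIdeal_notMem hfalg
      (posPart_nonneg (k • |z| - growthWeight e M))
      (fun h0 => hk (by rwa [posPart_eq_zero, sub_nonpos] at h0))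
    have hα : ∀ i, ∃ c, IsInfinitesimallyNear P e (a i) c := fun i => by
      have hi : |a i| ≤ e :=
        Finset.single_le_sum (f := fun i => |a i|) (fun j _ => abs_nonneg _) (Finset.mem_univ i)
      obtain ⟨c, -, hc⟩ := hP.exists_isInfinitesimallyNear he (r := -1) (s := 1) (by norm_num)
        (z := a i)
        (by rw [neg_one_smul, neg_le]; exact (neg_le_abs _).trans hi)
        (by rw [one_smul]; exact (le_abs_self _).trans hi)
      exact ⟨c, hc⟩
    choose α hα using hα
    obtain ⟨σ, hσ, hσe⟩ := hP.exists_isInfinitesimallyNear (add_nonneg he hee) (r := 0) (s := 1)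
      zero_le_one (z := e * e) (by simpa using hee) (by simpa using he)
    have hσe' : IsInfinitesimallyNear P (e + e * e) e (1 - σ) := fun ε hε => by
      obtain ⟨p, hp, h⟩ := hσe ε hε
      refine ⟨p, hp, h.trans' (le_of_eq ?_)⟩
      rw [← abs_neg]
      congr 1
      module
    have hφ : φ α σ = 0 := by
      have hcl : σ ∈ closure (Ioo (0 : ℝ) 1) := by rwa [closure_Ioo zero_ne_one]
      have hsub : Ioo (0 : ℝ) 1 ⊆ {u | φ α u = 0} := fun u hu => by
        have := hval α u hu
        rw [Pi.zero_apply, zero_mul] at this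
        exact (mul_eq_zero.1 this.symm).resolve_left hu.1.ne'
      exact closure_minimal hsub (isClosed_eq (hc α) continuous_const) hcl
    have hn := hnear P α σ hP hα hσe hσe'
    rw [hφ] at hn
    obtain ⟨p, hp, hzp⟩ := hn (1 / (k + 1)) (by positivity)
    rw [zero_smul, sub_zero, abs_abs] at hzp
    have hkz : k • |z| - growthWeight e M ≤ |k • p| := by
      rw [sub_le_iff_le_add]
      calc k • |z| ≤ k • ((1 / ((k : ℝ) + 1)) • growthWeight e M + p) := nsmul_le_nsmul_right hzp k
        _ = k • p + ((k : ℝ) * (1 / ((k : ℝ) + 1))) • growthWeight e M := by module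
        _ ≤ |k • p| + (1 : ℝ) • growthWeight e M := by
          gcongr
          · exact le_abs_self _
          · rw [mul_one_div, div_le_one (by positivity)]; linarith
        _ = |k • p| + growthWeight e M := by rw [one_smul]
    exact hyP (hP.mem_of_nonneg_of_le (posPart_nonneg _)
      (sup_le hkz (abs_nonneg _)) (hP.abs_mem (hP.nsmul_mem k hp)))
  exact le_antisymm ((le_abs_self z).trans hz.le)
    (by simpa using (neg_le_abs z).trans hz.le)

theorem GeneratedGraph.le_of_le
    (hfalg : ∀ a b z : A, a ⊓ b = 0 → 0 ≤ z → (z * a) ⊓ b = 0 ∧ (a * z) ⊓ b = 0)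
    (harch : ∀ a b : A, 0 ≤ a → 0 ≤ b → (∀ k : ℕ, k • a ≤ b) → a = 0)
    {n : ℕ} {a : Fin n → A} {f g : (Fin n → ℝ) → ℝ} {z w : A} (hf : GeneratedGraph a f z)
    (hg : GeneratedGraph a g w) (hfg : f ≤ g) : z ≤ w := by
  have h := (hf.sup hg).sub hg
  rw [sup_eq_right.2 hfg, sub_self] at h
  rw [← sup_eq_right, ← sub_eq_zero]
  exact h.eq_zero hfalg harch

end FAlgebra

section PolyGrowth

variable {n : ℕ} {f g : (Fin n → ℝ) → ℝ}

theorem one_le_one_add_sum_abs (t : Fin n → ℝ) : 1 ≤ 1 + ∑ i, |t i| :=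
  le_add_of_nonneg_right (Finset.sum_nonneg fun _ _ => abs_nonneg _)

theorem PolyGrowth.of_abs_le_add (hf : PolyGrowth n f) (hg : PolyGrowth n g)
    {k : (Fin n → ℝ) → ℝ} (hk : Continuous k) (h : ∀ t, |k t| ≤ |f t| + |g t|) :
    PolyGrowth n k := by
  obtain ⟨-, M, N, hM, hf⟩ := hf
  obtain ⟨-, M', N', hM', hg⟩ := hg
  refine ⟨hk, M + M', N + N', add_nonneg hM hM', fun t => ?_⟩
  have h1 := one_le_one_add_sum_abs t
  calc |k t| ≤ M * (1 + ∑ i, |t i|) ^ N + M' * (1 + ∑ i, |t i|) ^ N' :=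
        (h t).trans (add_le_add (hf t) (hg t))
    _ ≤ M * (1 + ∑ i, |t i|) ^ (N + N') + M' * (1 + ∑ i, |t i|) ^ (N + N') := by
        gcongr <;> first | exact h1 | omega
    _ = (M + M') * (1 + ∑ i, |t i|) ^ (N + N') := by ring

theorem PolyGrowth.smul (c : ℝ) (hf : PolyGrowth n f) : PolyGrowth n (c • f) := by
  obtain ⟨hc, M, N, hM, hf⟩ := hf
  refine ⟨hc.const_smul c, |c| * M, N, by positivity, fun t => ?_⟩
  rw [Pi.smul_apply, smul_eq_mul, abs_mul, mul_assoc]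
  exact mul_le_mul_of_nonneg_left (hf t) (abs_nonneg c)

theorem PolyGrowth.mul (hf : PolyGrowth n f) (hg : PolyGrowth n g) : PolyGrowth n (f * g) := by
  obtain ⟨hc, M, N, hM, hf⟩ := hf
  obtain ⟨hc', M', N', hM', hg⟩ := hg
  refine ⟨hc.mul hc', M * M', N + N', by positivity, fun t => ?_⟩
  rw [Pi.mul_apply, abs_mul, pow_add, mul_mul_mul_comm]
  exact mul_le_mul (hf t) (hg t) (abs_nonneg _) ((abs_nonneg _).trans (hf t))

theorem polyGrowthH_zero : PolyGrowthH n 0 :=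
  ⟨⟨continuous_const, 0, 0, le_rfl, by simp⟩, 0, fun _ _ ε hε =>
    ⟨1, one_pos, by simpa using fun _ _ _ _ _ => hε⟩⟩

theorem polyGrowthH_eval (i : Fin n) : PolyGrowthH n fun t => t i := by
  refine ⟨⟨continuous_apply i, 1, 1, zero_le_one, fun t => ?_⟩, fun t => t i,
    fun _ _ ε hε => ⟨1, one_pos, fun t ht _ y _ => ?_⟩⟩
  · have := Finset.single_le_sum (f := fun i => |t i|) (fun j _ => abs_nonneg _)
      (Finset.mem_univ i)
    rw [one_mul, pow_one]
    linarith
  · simpa [mul_div_cancel_left₀ _ ht.ne'] using hε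

theorem PolyGrowthH.add (hf : PolyGrowthH n f) (hg : PolyGrowthH n g) : PolyGrowthH n (f + g) := by
  obtain ⟨hf, fh, hfh⟩ := hf
  obtain ⟨hg, gh, hgh⟩ := hg
  refine ⟨hf.of_abs_le_add hg (hf.1.add hg.1) fun t => abs_add_le _ _, fh + gh,
    fun B hB ε hε => ?_⟩
  obtain ⟨δ, hδ, h⟩ := hfh B hB (ε / 2) (half_pos hε)
  obtain ⟨δ', hδ', h'⟩ := hgh B hB (ε / 2) (half_pos hε)
  refine ⟨min δ δ', lt_min hδ hδ', fun t ht htδ y hy => ?_⟩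
  have h1 := h t ht (htδ.trans_le (min_le_left _ _)) y hy
  have h2 := h' t ht (htδ.trans_le (min_le_right _ _)) y hy
  calc |(f + g) (t • y) / t - (fh + gh) y| = |(f (t • y) / t - fh y) + (g (t • y) / t - gh y)| := by
        congr 1; simp only [Pi.add_apply]; ring
    _ ≤ _ := abs_add_le _ _
    _ < ε := by linarith

theorem PolyGrowthH.sup (hf : PolyGrowthH n f) (hg : PolyGrowthH n g) : PolyGrowthH n (f ⊔ g) := by
  obtain ⟨hf, fh, hfh⟩ := hf
  obtain ⟨hg, gh, hgh⟩ := hg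
  refine ⟨hf.of_abs_le_add hg (hf.1.sup hg.1) fun t => ?_, fh ⊔ gh, fun B hB ε hε => ?_⟩
  · exact abs_max_le_max_abs_abs.trans (max_le_add_of_nonneg (abs_nonneg _) (abs_nonneg _))
  obtain ⟨δ, hδ, h⟩ := hfh B hB ε hε
  obtain ⟨δ', hδ', h'⟩ := hgh B hB ε hε
  refine ⟨min δ δ', lt_min hδ hδ', fun t ht htδ y hy => ?_⟩
  have h1 := h t ht (htδ.trans_le (min_le_left _ _)) y hy
  have h2 := h' t ht (htδ.trans_le (min_le_right _ _)) y hy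
  calc |(f ⊔ g) (t • y) / t - (fh ⊔ gh) y|
      = |max (f (t • y) / t) (g (t • y) / t) - max (fh y) (gh y)| := by
        rw [max_div_div_right ht.le]; rfl
    _ ≤ _ := abs_max_sub_max_le_max _ _ _ _
    _ < ε := max_lt h1 h2

theorem PolyGrowthH.smul (c : ℝ) (hf : PolyGrowthH n f) : PolyGrowthH n (c • f) := by
  obtain ⟨hf, fh, hfh⟩ := hf
  refine ⟨hf.smul c, c • fh, fun B hB ε hε => ?_⟩
  have hc : 0 < |c| + 1 := by positivity
  obtain ⟨δ, hδ, h⟩ := hfh B hB (ε / (|c| + 1)) (by positivity)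
  refine ⟨δ, hδ, fun t ht htδ y hy => ?_⟩
  have h1 := h t ht htδ y hy
  rw [lt_div_iff₀ hc] at h1
  calc |(c • f) (t • y) / t - (c • fh) y| = |c| * |f (t • y) / t - fh y| := by
        rw [← abs_mul]; congr 1; simp only [Pi.smul_apply, smul_eq_mul]; ring
    _ < ε := by nlinarith [abs_nonneg (f (t • y) / t - fh y)]

theorem PolyGrowthH.exists_abs_div_le (hf : PolyGrowthH n f) {B : Set (Fin n → ℝ)}
    (hB : Bornology.IsBounded B) :
    ∃ C δ : ℝ, 0 < C ∧ 0 < δ ∧ ∀ t : ℝ, 0 < t → t < δ → ∀ y ∈ B, |f (t • y) / t| ≤ C := by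
  obtain ⟨hf, fh, hfh⟩ := hf
  obtain ⟨δ, hδ, h⟩ := hfh B hB 1 one_pos
  have hδ2 : 0 < δ / 2 := half_pos hδ
  obtain ⟨C, hC⟩ := hB.isCompact_closure.exists_bound_of_continuousOn
    (f := fun y => f ((δ / 2) • y) / (δ / 2))
    ((hf.1.comp (continuous_const_smul _)).div_const _).continuousOn
  refine ⟨|C| + 2, δ, by positivity, hδ, fun t ht htδ y hy => ?_⟩
  have h1 := abs_sub_lt_iff.1 (h t ht htδ y hy)
  have h2 := abs_sub_lt_iff.1 (h (δ / 2) hδ2 (by linarith) y hy)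
  have h3 := hC y (subset_closure hy)
  rw [Real.norm_eq_abs] at h3
  have h4 := abs_le.1 (h3.trans (le_abs_self C))
  rw [abs_le]
  constructor <;> linarith [h1.1, h1.2, h2.1, h2.2, h4.1, h4.2]

theorem PolyGrowthH.mul (hf : PolyGrowthH n f) (hg : PolyGrowthH n g) : PolyGrowthH n (f * g) := by
  refine ⟨hf.1.mul hg.1, 0, fun B hB ε hε => ?_⟩
  obtain ⟨C, δ, hC, hδ, h⟩ := hf.exists_abs_div_le hB
  obtain ⟨C', δ', hC', hδ', h'⟩ := hg.exists_abs_div_le hB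
  refine ⟨min (min δ δ') (ε / (C * C')), by positivity, fun t ht htδ y hy => ?_⟩
  obtain ⟨h0, h3⟩ := lt_min_iff.1 htδ
  obtain ⟨h1, h2⟩ := lt_min_iff.1 h0
  rw [lt_div_iff₀ (by positivity)] at h3
  calc |(f * g) (t • y) / t - (0 : (Fin n → ℝ) → ℝ) y|
      = t * (|f (t • y) / t| * |g (t • y) / t|) := by
        have h4 : (f * g) (t • y) / t - (0 : (Fin n → ℝ) → ℝ) y
            = t * (f (t • y) / t * (g (t • y) / t)) := by
          rw [Pi.mul_apply, Pi.zero_apply, sub_zero]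
          field_simp
        rw [h4, abs_mul, abs_mul, abs_of_pos ht]
    _ ≤ t * (C * C') := by
        gcongr
        exacts [h t ht h1 y hy, h' t ht h2 y hy]
    _ < ε := h3

theorem PolyGrowthH.apply_zero (hf : PolyGrowthH n f) : f 0 = 0 := by
  obtain ⟨C, δ, hC, hδ, h⟩ := hf.exists_abs_div_le (Bornology.isBounded_singleton (x := 0))
  by_contra h0
  have hpos : 0 < |f 0| := abs_pos.2 h0
  have ht : 0 < min (δ / 2) (|f 0| / (2 * C)) := by positivity
  have := h _ ht ((min_le_left _ _).trans_lt (half_lt_self hδ)) 0 rfl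
  rw [smul_zero, abs_div, abs_of_pos ht, div_le_iff₀ ht] at this
  have h2 : C * min (δ / 2) (|f 0| / (2 * C)) ≤ C * (|f 0| / (2 * C)) := by
    gcongr; exact min_le_right _ _
  have h3 : C * (|f 0| / (2 * C)) = |f 0| / 2 := by field_simp
  linarith

theorem GeneratedGraph.polyGrowthH {A : Type*} [Lattice A] [NonUnitalRing A] [Module ℝ A]
    {a : Fin n → A} {z : A} (h : GeneratedGraph a f z) : PolyGrowthH n f := by
  induction h with
  | zero => exact polyGrowthH_zero
  | gen i => exact polyGrowthH_eval i
  | add _ _ h1 h2 => exact h1.add h2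
  | smul c _ h => exact h.smul c
  | sup _ _ h1 h2 => exact h1.sup h2
  | mul _ _ h1 h2 => exact h1.mul h2

end PolyGrowth

section Density

variable {n : ℕ}

/-- The product of the unit interval and the unit sphere of the `ℓ¹`-norm. -/
def unitCylinder (n : ℕ) : Set (ℝ × (Fin n → ℝ)) := {p | p.1 ∈ Icc 0 1 ∧ ∑ i, |p.2 i| = 1}

theorem isCompact_unitCylinder : IsCompact (unitCylinder n) := by
  have hcl : IsClosed (unitCylinder n) :=
    (isClosed_Icc.preimage continuous_fst).inter
      (isClosed_eq (f := fun p : ℝ × (Fin n → ℝ) => ∑ i, |p.2 i|) (by fun_prop) continuous_const)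
  refine ((isCompact_Icc (a := (0 : ℝ)) (b := 1)).prod
    (isCompact_closedBall (0 : Fin n → ℝ) 1)).of_isClosed_subset hcl ?_
  rintro p ⟨h1, h2⟩
  refine ⟨h1, ?_⟩
  rw [mem_closedBall_zero_iff, pi_norm_le_iff_of_nonneg zero_le_one]
  intro i
  rw [Real.norm_eq_abs, ← h2]
  exact Finset.single_le_sum (f := fun i => |p.2 i|) (fun j _ => abs_nonneg _) (Finset.mem_univ i)

/-- Reparametrizing the rays by `u ↦ u / (1 - u)`, a function in `PG_n^h` divided by a suitable
weight extends continuously to both ends of every ray. -/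
theorem PolyGrowthH.exists_continuousOn_unitCylinder {f : (Fin n → ℝ) → ℝ}
    (hf : PolyGrowthH n f) : ∃ (N : ℕ) (F : ℝ × (Fin n → ℝ) → ℝ),
      ContinuousOn F (unitCylinder n) ∧ ∀ p ∈ unitCylinder n, p.1 ∈ Ioo 0 1 →
        f ((p.1 / (1 - p.1)) • p.2) * (1 - p.1) ^ (N + 2) = p.1 * F p := by
  obtain ⟨⟨hc, C, N, hC, hfC⟩, fh, hfh⟩ := hf
  have hB : Bornology.IsBounded (Prod.snd '' unitCylinder n) :=
    (isCompact_unitCylinder.image continuous_snd).isBounded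
  have hfhc : ContinuousOn fh (Prod.snd '' unitCylinder n) := by
    refine TendstoUniformlyOn.continuousOn (p := 𝓝[>] (0 : ℝ))
      (F := fun t y => f (t • y) / t) ?_ (Eventually.of_forall fun t =>
        ((hc.comp (continuous_const_smul t)).div_const t).continuousOn).frequently
    rw [Metric.tendstoUniformlyOn_iff]
    intro ε hε
    obtain ⟨δ, hδ, h⟩ := hfh _ hB ε hε
    filter_upwards [Ioo_mem_nhdsGT hδ] with t ht y hy
    rw [dist_comm]
    exact h t ht.1 ht.2 y hy
  set F : ℝ × (Fin n → ℝ) → ℝ := fun p => if p.1 = 0 then fh p.2 else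
    f ((p.1 / (1 - p.1)) • p.2) * (1 - p.1) ^ (N + 2) / p.1 with hF
  have hF0 : ∀ p : ℝ × (Fin n → ℝ), p.1 ≠ 0 →
      F p = f ((p.1 / (1 - p.1)) • p.2) * (1 - p.1) ^ (N + 2) / p.1 := fun p hp => if_neg hp
  refine ⟨N, F, ?_, fun p _ hp => by rw [hF0 p hp.1.ne', mul_div_cancel₀ _ hp.1.ne']⟩
  rintro ⟨u, s⟩ ⟨hu, hs⟩
  dsimp only at hu hs
  rcases hu.1.eq_or_lt with rfl | hu0
  · set H : ℝ × (Fin n → ℝ) → ℝ := fun p => fh p.2 * (1 - p.1) ^ (N + 1) with hHdef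
    have hH : ContinuousWithinAt H (unitCylinder n) (0, s) := by
      refine ContinuousWithinAt.mul ?_ (by fun_prop)
      exact (hfhc s ⟨(0, s), ⟨hu, hs⟩, rfl⟩).comp (t := Prod.snd '' unitCylinder n)
        (f := Prod.snd) continuous_snd.continuousWithinAt (mapsTo_image _ _)
    have key : Tendsto (fun p => F p - H p) (𝓝[unitCylinder n] (0, s)) (𝓝 0) := by
      rw [Metric.tendsto_nhds]
      intro ε hε
      obtain ⟨δ, hδ, h⟩ := hfh _ hB ε hε
      have hlt : ∀ᶠ p : ℝ × (Fin n → ℝ) in 𝓝[unitCylinder n] (0, s), p.1 < min (1 / 2) (δ / 2) :=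
        nhdsWithin_le_nhds (continuous_fst.continuousAt.eventually_lt_const
          (show (0 : ℝ) < min (1 / 2) (δ / 2) by positivity))
      filter_upwards [hlt, self_mem_nhdsWithin] with p hp hpK
      rw [Real.dist_eq, sub_zero]
      obtain ⟨hp1, hp2⟩ := lt_min_iff.1 hp
      rcases hpK.1.1.eq_or_lt with h0 | h0
      · simpa [hF, hHdef, ← h0] using hε
      have hv : 0 < 1 - p.1 := by linarith
      have ht : p.1 / (1 - p.1) < δ := by
        rw [div_lt_iff₀ hv]
        nlinarith
      have h1 := h _ (div_pos h0 hv) ht p.2 (mem_image_of_mem _ hpK)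
      have h2 : F p - H p = (f ((p.1 / (1 - p.1)) • p.2) / (p.1 / (1 - p.1)) - fh p.2)
          * (1 - p.1) ^ (N + 1) := by
        rw [hF0 p h0.ne', hHdef]
        field_simp
        ring
      rw [h2, abs_mul, abs_of_nonneg (pow_nonneg hv.le _)]
      exact (mul_le_of_le_one_right (abs_nonneg _) (pow_le_one₀ hv.le (by linarith))).trans_lt h1
    have hval : H (0, s) = F (0, s) := by simp [hF, hHdef]
    have h := key.add hH
    rw [ContinuousWithinAt]
    simpa only [sub_add_cancel, zero_add, hval] using h
  rcases hu.2.eq_or_lt with rfl | hu1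
  · have hval : F (1, s) = 0 := by simp [hF]
    rw [ContinuousWithinAt, hval]
    refine squeeze_zero_norm' (a := fun p => C * (1 - p.1) ^ 2 / p.1) ?_ ?_
    · have hlt : ∀ᶠ p : ℝ × (Fin n → ℝ) in 𝓝[unitCylinder n] (1, s), 0 < p.1 :=
        nhdsWithin_le_nhds (continuous_fst.continuousAt.eventually_const_lt
          (show (0 : ℝ) < 1 by positivity))
      filter_upwards [hlt, self_mem_nhdsWithin] with p h0 hpK
      rw [hF0 p h0.ne', Real.norm_eq_abs, abs_div, abs_of_pos h0]
      gcongr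
      rcases hpK.1.2.eq_or_lt with h1 | h1
      · simp [h1]
      have hv : 0 < 1 - p.1 := by linarith
      have h2 := hfC ((p.1 / (1 - p.1)) • p.2)
      have h3 : 1 + ∑ i, |((p.1 / (1 - p.1)) • p.2) i| = (1 - p.1)⁻¹ := by
        simp only [Pi.smul_apply, smul_eq_mul, abs_mul, ← Finset.mul_sum]
        rw [hpK.2, abs_of_pos (div_pos h0 hv)]
        field_simp
        ring
      rw [h3] at h2
      rw [abs_mul, abs_of_nonneg (pow_nonneg hv.le _)]
      calc _ ≤ C * (1 - p.1)⁻¹ ^ N * (1 - p.1) ^ (N + 2) := by gcongr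
        _ = C * (1 - p.1) ^ 2 := by
          rw [inv_pow, pow_add]
          field_simp
    · have : ContinuousAt (fun p : ℝ × (Fin n → ℝ) => C * (1 - p.1) ^ 2 / p.1) (1, s) := by
        fun_prop (disch := norm_num)
      simpa using (this.tendsto.mono_left nhdsWithin_le_nhds :
        Tendsto _ (𝓝[unitCylinder n] (1, s)) _)
  · have hv : (1 - (u, s).1 : ℝ) ≠ 0 := by simpa [sub_eq_zero] using hu1.ne'
    have hu' : (u, s).1 ≠ 0 := hu0.ne'
    have h1 : ContinuousAt (fun p : ℝ × (Fin n → ℝ) => (p.1 / (1 - p.1)) • p.2) (u, s) := by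
      fun_prop (disch := assumption)
    have h2 : ContinuousAt (fun p : ℝ × (Fin n → ℝ) =>
        f ((p.1 / (1 - p.1)) • p.2) * (1 - p.1) ^ (N + 2) / p.1) (u, s) :=
      ((hc.continuousAt.comp h1).mul (by fun_prop)).div continuousAt_fst hu'
    refine (h2.congr ?_).continuousWithinAt
    filter_upwards [continuous_fst.continuousAt.eventually_ne hu'] with p hp
    exact (hF0 p hp).symm

variable {A : Type*} [Lattice A] [NonUnitalRing A] [Module ℝ A] {a : Fin n → A}

theorem GeneratedGraph.exists_sum_abs (a : Fin n → A) :
    ∃ e, GeneratedGraph a (fun t => ∑ i, |t i|) e := by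
  refine ⟨∑ i, |a i|, ?_⟩
  convert GeneratedGraph.sum Finset.univ fun i _ => (GeneratedGraph.gen i : GeneratedGraph a _ _).abs
    using 1
  ext t
  simp [Finset.sum_apply, Pi.abs_apply]

theorem GeneratedGraph.exists_mul_one_add_pow {f g : (Fin n → ℝ) → ℝ} {z e : A}
    (hf : GeneratedGraph a f z) (hg : GeneratedGraph a g e) (k : ℕ) :
    ∃ w, GeneratedGraph a (fun t => f t * (1 + g t) ^ k) w := by
  induction k with
  | zero => exact ⟨z, by simpa using hf⟩
  | succ k ih =>
    obtain ⟨w, hw⟩ := ih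
    refine ⟨w + w * e, ?_⟩
    convert hw.add (hw.mul hg) using 1
    ext t
    simp only [Pi.add_apply, Pi.mul_apply]
    ring

/-- The continuous functions on the cylinder that represent elements of the lattice-algebra
generated by the coordinates, up to a weight of order `N + 2`. -/
def cylinderTrace (a : Fin n → A) (N : ℕ) : Submodule ℝ C(unitCylinder n, ℝ) where
  carrier := {φ | ∃ g b, GeneratedGraph a g b ∧ ∀ p : unitCylinder n, p.1.1 ∈ Ioo 0 1 →
    g ((p.1.1 / (1 - p.1.1)) • p.1.2) * (1 - p.1.1) ^ (N + 2) = p.1.1 * φ p}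
  zero_mem' := ⟨0, 0, .zero, by simp⟩
  add_mem' := by
    rintro φ ψ ⟨g, b, hg, hφ⟩ ⟨k, d, hk, hψ⟩
    refine ⟨_, _, hg.add hk, fun p hp => ?_⟩
    rw [Pi.add_apply, add_mul, hφ p hp, hψ p hp, ContinuousMap.add_apply, mul_add]
  smul_mem' := by
    rintro c φ ⟨g, b, hg, hφ⟩
    refine ⟨_, _, hg.smul c, fun p hp => ?_⟩
    rw [Pi.smul_apply, smul_mul_assoc, hφ p hp, ContinuousMap.smul_apply, smul_eq_mul, smul_eq_mul]
    ring

theorem sup_mem_cylinderTrace {N : ℕ} {φ ψ : C(unitCylinder n, ℝ)} (hφ : φ ∈ cylinderTrace a N)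
    (hψ : ψ ∈ cylinderTrace a N) : φ ⊔ ψ ∈ cylinderTrace a N := by
  obtain ⟨g, b, hg, hφ⟩ := hφ
  obtain ⟨k, d, hk, hψ⟩ := hψ
  refine ⟨_, _, hg.sup hk, fun p hp => ?_⟩
  have hv : 0 ≤ (1 - p.1.1) ^ (N + 2) := pow_nonneg (sub_nonneg.2 hp.2.le) _
  rw [Pi.sup_apply, max_mul_of_nonneg _ _ hv, hφ p hp, hψ p hp, ContinuousMap.sup_apply,
    mul_max_of_nonneg _ _ hp.1.le]

theorem separatesPointsStrongly_cylinderTrace (a : Fin n → A) (N : ℕ) :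
    (cylinderTrace a N : Set C(unitCylinder n, ℝ)).SeparatesPointsStrongly := by
  obtain ⟨e, he⟩ := GeneratedGraph.exists_sum_abs a
  have hρ : ∀ p : unitCylinder n, p.1.1 ∈ Ioo 0 1 →
      ∑ i, |((p.1.1 / (1 - p.1.1)) • p.1.2) i| = p.1.1 / (1 - p.1.1) := fun p hp => by
    have hv := sub_pos.2 hp.2
    simp only [Pi.smul_apply, smul_eq_mul, abs_mul, ← Finset.mul_sum]
    rw [p.2.2, mul_one, abs_of_pos (div_pos hp.1 hv)]
  have hone : ∀ u : ℝ, u ∈ Ioo 0 1 → 1 + u / (1 - u) = (1 - u)⁻¹ := fun u hu => by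
    have hv := sub_pos.2 hu.2
    field_simp
    ring
  have h1 : (1 : C(unitCylinder n, ℝ)) ∈ cylinderTrace a N := by
    obtain ⟨w, hw⟩ := he.exists_mul_one_add_pow he (N + 1)
    refine ⟨_, w, hw, fun p hp => ?_⟩
    have hv := sub_pos.2 hp.2
    rw [hρ p hp, hone _ hp, inv_pow]
    simp only [ContinuousMap.one_apply]
    field_simp
    ring
  have h2 : (⟨fun p => 1 - p.1.1, by fun_prop⟩ : C(unitCylinder n, ℝ)) ∈ cylinderTrace a N := by
    obtain ⟨w, hw⟩ := he.exists_mul_one_add_pow he N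
    refine ⟨_, w, hw, fun p hp => ?_⟩
    have hv := sub_pos.2 hp.2
    rw [hρ p hp, hone _ hp, inv_pow]
    simp only [ContinuousMap.coe_mk]
    field_simp
    ring
  have h3 : ∀ i, (⟨fun p => p.1.2 i, by fun_prop⟩ : C(unitCylinder n, ℝ)) ∈ cylinderTrace a N := by
    intro i
    obtain ⟨w, hw⟩ := (GeneratedGraph.gen i : GeneratedGraph a _ _).exists_mul_one_add_pow he (N + 1)
    refine ⟨_, w, hw, fun p hp => ?_⟩
    have hv := sub_pos.2 hp.2
    rw [hρ p hp, hone _ hp, inv_pow]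
    simp only [ContinuousMap.coe_mk, Pi.smul_apply, smul_eq_mul]
    field_simp
    ring
  intro v x y
  by_cases hxy : x = y
  · subst hxy
    exact ⟨v x • 1, Submodule.smul_mem _ _ h1, by simp, by simp⟩
  have hsep : ∃ ψ ∈ cylinderTrace a N, ψ x ≠ ψ y := by
    by_contra! hcon
    refine hxy (Subtype.ext (Prod.ext ?_ (funext fun i => hcon _ (h3 i))))
    simpa using hcon _ h2
  obtain ⟨ψ, hψ, hne⟩ := hsep
  have hne' : ψ y - ψ x ≠ 0 := sub_ne_zero.2 hne.symm
  refine ⟨v x • 1 + ((v y - v x) / (ψ y - ψ x)) • (ψ - ψ x • 1), add_mem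
    (Submodule.smul_mem _ _ h1) (Submodule.smul_mem _ _ (sub_mem hψ (Submodule.smul_mem _ _ h1))),
    by simp, ?_⟩
  simp [div_mul_cancel₀ _ hne']

/-- The lattice-algebra generated by the coordinates is relatively uniformly dense in `PG_n^h`. -/
theorem PolyGrowthH.exists_approx {f : (Fin n → ℝ) → ℝ} (hf : PolyGrowthH n f) (a : Fin n → A) :
    ∃ h c, GeneratedGraph a h c ∧ (∀ x, 0 ≤ h x) ∧ ∀ ε : ℝ, 0 < ε → ∃ g b,
      GeneratedGraph a g b ∧ ∀ x, |f x - g x| ≤ ε * h x := by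
  obtain ⟨N, F, hF, hfF⟩ := hf.exists_continuousOn_unitCylinder
  obtain ⟨e, he⟩ := GeneratedGraph.exists_sum_abs a
  obtain ⟨c, hc⟩ := he.exists_mul_one_add_pow he (N + 1)
  have hρ : ∀ x : Fin n → ℝ, 0 ≤ ∑ i, |x i| := fun x => Finset.sum_nonneg fun i _ => abs_nonneg _
  refine ⟨_, c, hc, fun x => mul_nonneg (hρ x) (pow_nonneg (add_nonneg zero_le_one (hρ x)) _),
    fun ε hε => ?_⟩
  have : CompactSpace (unitCylinder n) := isCompact_iff_compactSpace.1 isCompact_unitCylinder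
  have hdense : closure (cylinderTrace a N : Set C(unitCylinder n, ℝ)) = ⊤ := by
    refine ContinuousMap.sublattice_closure_eq_top _ ⟨0, zero_mem _⟩ (fun φ hφ ψ hψ => ?_)
      (fun φ hφ ψ hψ => sup_mem_cylinderTrace hφ hψ) (separatesPointsStrongly_cylinderTrace a N)
    have : φ ⊓ ψ = -(-φ ⊔ -ψ) := by
      ext p
      simp [← min_neg_neg]
    rw [this]
    exact neg_mem (sup_mem_cylinderTrace (neg_mem hφ) (neg_mem hψ))
  have hmem : (⟨_, continuousOn_iff_continuous_domRestrict.1 hF⟩ : C(unitCylinder n, ℝ)) ∈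
      closure (cylinderTrace a N : Set C(unitCylinder n, ℝ)) := hdense ▸ mem_univ _
  obtain ⟨φ, ⟨g, b, hg, hgφ⟩, hdist⟩ := Metric.mem_closure_iff.1 hmem ε hε
  refine ⟨g, b, hg, fun x => ?_⟩
  rcases (hρ x).eq_or_lt with h0 | h0
  · have hx : x = 0 := funext fun i =>
      abs_eq_zero.1 ((Finset.sum_eq_zero_iff_of_nonneg fun i _ => abs_nonneg _).1 h0.symm i
        (Finset.mem_univ i))
    simp [hx, hf.apply_zero, hg.apply_zero]
  set ρ := ∑ i, |x i| with hρdef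
  have h1 : 0 < 1 + ρ := by positivity
  have hu : ρ / (1 + ρ) ∈ Ioo (0 : ℝ) 1 :=
    ⟨div_pos h0 h1, (div_lt_one h1).2 (lt_one_add ρ)⟩
  have hv : 1 - ρ / (1 + ρ) = (1 + ρ)⁻¹ := by field_simp; ring
  have huv : ρ / (1 + ρ) / (1 - ρ / (1 + ρ)) = ρ := by rw [hv]; field_simp
  have hp : (ρ / (1 + ρ), ρ⁻¹ • x) ∈ unitCylinder n := by
    refine ⟨Ioo_subset_Icc_self hu, ?_⟩
    simp only [Pi.smul_apply, smul_eq_mul, abs_mul, ← Finset.mul_sum]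
    rw [abs_of_pos (inv_pos.2 h0), ← hρdef, inv_mul_cancel₀ h0.ne']
  have hf' := hfF _ hp hu
  have hg' := hgφ ⟨_, hp⟩ hu
  dsimp only at hf' hg'
  rw [huv, hv, smul_inv_smul₀ h0.ne'] at hf' hg'
  have hd := ((ContinuousMap.dist_apply_le_dist (⟨_, hp⟩ : unitCylinder n)).trans_lt hdist).le
  rw [Real.dist_eq] at hd
  have heq : f x - g x = ρ * (1 + ρ) ^ (N + 1) *
      (F (ρ / (1 + ρ), ρ⁻¹ • x) - φ ⟨(ρ / (1 + ρ), ρ⁻¹ • x), hp⟩) := by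
    have h2 : (f x - g x) * (1 + ρ)⁻¹ ^ (N + 2) = ρ / (1 + ρ) *
        (F (ρ / (1 + ρ), ρ⁻¹ • x) - φ ⟨(ρ / (1 + ρ), ρ⁻¹ • x), hp⟩) := by
      rw [sub_mul, hf', hg', mul_sub]
    rw [inv_pow, ← div_eq_mul_inv, div_eq_iff (by positivity)] at h2
    rw [h2]
    field_simp
    ring
  rw [heq, abs_mul, abs_of_nonneg (by positivity), mul_comm]
  exact mul_le_mul_of_nonneg_right hd (by positivity)

end Density

/-- `z` is the value of `f` at `a`: `f` and `z` are simultaneously relatively uniform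
limits of the functions and values generated by the coordinates and by `a`. -/
def IsCalculusValue {A : Type*} [Lattice A] [NonUnitalRing A] [Module ℝ A] {n : ℕ} (a : Fin n → A)
    (f : (Fin n → ℝ) → ℝ) (z : A) : Prop :=
  ∃ h c, GeneratedGraph a h c ∧ (∀ x, 0 ≤ h x) ∧ ∀ ε : ℝ, 0 < ε → ∃ g b,
    GeneratedGraph a g b ∧ (∀ x, |f x - g x| ≤ ε * h x) ∧ |z - b| ≤ ε • c

section FunctionalCalculus

variable {A : Type*} [Lattice A] [NonUnitalRing A] [IsOrderedAddMonoid A]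
  [PosMulMono A] [MulPosMono A] [Module ℝ A] [IsOrderedModule ℝ A]

theorem eq_zero_of_forall_le_smul
    (harch : ∀ a b : A, 0 ≤ a → 0 ≤ b → (∀ k : ℕ, k • a ≤ b) → a = 0) {x y : A} (hx : 0 ≤ x)
    (hy : 0 ≤ y) (h : ∀ ε : ℝ, 0 < ε → x ≤ ε • y) : x = 0 := by
  refine harch x y hx hy fun k => ?_
  have hk : (0 : ℝ) < k + 1 := by positivity
  calc k • x ≤ (k + 1) • x := nsmul_le_nsmul_left hx k.le_succ
    _ = ((k : ℝ) + 1) • x := by rw [← Nat.cast_smul_eq_nsmul ℝ, Nat.cast_succ]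
    _ ≤ ((k : ℝ) + 1) • ((k + 1 : ℝ)⁻¹ • y) :=
        smul_le_smul_of_nonneg_left (h _ (inv_pos.2 hk)) hk.le
    _ = y := smul_inv_smul₀ hk.ne' y

theorem regNorm_le {e x : A} {c : ℝ} (hc : 0 ≤ c) (h : |x| ≤ c • e) : regNorm e x ≤ c :=
  csInf_le ⟨0, fun _ hd => hd.1⟩ ⟨hc, h⟩

theorem abs_le_smul_of_regNorm_lt {e x : A} {c : ℝ} (he : 0 ≤ e) (hx : x ∈ idealSet e)
    (h : regNorm e x < c) : |x| ≤ c • e := by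
  obtain ⟨d, hd, hdc⟩ := exists_lt_of_csInf_lt hx h
  exact hd.2.trans (smul_le_smul_of_nonneg_right hdc.le he)

theorem sub_mem_idealSet {e x y : A} (hx : x ∈ idealSet e) (hy : y ∈ idealSet e) :
    x - y ∈ idealSet e := by
  obtain ⟨c, hc, hx⟩ := hx
  obtain ⟨d, hd, hy⟩ := hy
  refine ⟨c + d, add_nonneg hc hd, ?_⟩
  rw [add_smul, sub_eq_add_neg]
  refine (abs_add_le x (-y)).trans (add_le_add hx ?_)
  rwa [abs_neg]

variable [IsScalarTower ℝ A A] [SMulCommClass ℝ A A]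

theorem abs_mul_sub_mul_le {z w b d p q r s : A} {δ : ℝ} (hδ : 0 ≤ δ) (hδ1 : δ ≤ 1)
    (hz : |z| ≤ p) (hw : |w| ≤ q) (hs : 0 ≤ s) (hb : |z - b| ≤ δ • r)
    (hd : |w - d| ≤ δ • s) : |z * w - b * d| ≤ δ • (p * s + r * (q + s)) := by
  have hd' : |d| ≤ q + s := by
    calc |d| = |w + -(w - d)| := by congr 1; abel
      _ ≤ |w| + |-(w - d)| := abs_add_le _ _
      _ ≤ q + (1 : ℝ) • s := by
        rw [abs_neg]
        exact add_le_add hw (hd.trans (smul_le_smul_of_nonneg_right hδ1 hs))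
      _ = q + s := by rw [one_smul]
  calc |z * w - b * d| = |z * (w - d) + (z - b) * d| := by
        congr 1; rw [mul_sub, sub_mul]; abel
    _ ≤ |z * (w - d)| + |(z - b) * d| := abs_add_le _ _
    _ ≤ |z| * |w - d| + |z - b| * |d| := add_le_add (abs_mul_le_mul_abs _ _) (abs_mul_le_mul_abs _ _)
    _ ≤ p * (δ • s) + (δ • r) * (q + s) := by
        refine add_le_add ?_ ?_
        · exact mul_le_mul_of_nonneg hz hd (abs_nonneg _) (smul_nonneg hδ hs)
        · exact mul_le_mul_of_nonneg hb hd' (abs_nonneg _) ((abs_nonneg _).trans hd')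
    _ = δ • (p * s + r * (q + s)) := by rw [mul_smul_comm, smul_mul_assoc, ← smul_add]

variable {n : ℕ} {a : Fin n → A} {f g : (Fin n → ℝ) → ℝ} {z w : A}

theorem GeneratedGraph.isCalculusValue (h : GeneratedGraph a f z) : IsCalculusValue a f z :=
  ⟨0, 0, .zero, fun _ => le_rfl, fun _ _ => ⟨f, z, h, by simp, by simp⟩⟩

theorem GeneratedGraph.nonneg
    (hfalg : ∀ a b z : A, a ⊓ b = 0 → 0 ≤ z → (z * a) ⊓ b = 0 ∧ (a * z) ⊓ b = 0)
    (harch : ∀ a b : A, 0 ≤ a → 0 ≤ b → (∀ k : ℕ, k • a ≤ b) → a = 0)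
    (h : GeneratedGraph a f z) (hf : ∀ x, 0 ≤ f x) : 0 ≤ z :=
  GeneratedGraph.zero.le_of_le hfalg harch h hf

theorem GeneratedGraph.abs_sub_le
    (hfalg : ∀ a b z : A, a ⊓ b = 0 → 0 ≤ z → (z * a) ⊓ b = 0 ∧ (a * z) ⊓ b = 0)
    (harch : ∀ a b : A, 0 ≤ a → 0 ≤ b → (∀ k : ℕ, k • a ≤ b) → a = 0)
    {h k l : (Fin n → ℝ) → ℝ} {b c d v : A} {ε δ : ℝ} (hg : GeneratedGraph a g b)
    (hk : GeneratedGraph a k d) (hh : GeneratedGraph a h c) (hl : GeneratedGraph a l v)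
    (hfg : ∀ x, |f x - g x| ≤ ε * h x) (hfk : ∀ x, |f x - k x| ≤ δ * l x) :
    |b - d| ≤ ε • c + δ • v := by
  refine (hg.sub hk).abs.le_of_le hfalg harch ((hh.smul ε).add (hl.smul δ)) fun x => ?_
  simp only [Pi.abs_apply, Pi.sub_apply, Pi.add_apply, Pi.smul_apply, smul_eq_mul]
  refine (_root_.abs_sub_le (g x) (f x) (k x)).trans (add_le_add ?_ (hfk x))
  rw [abs_sub_comm]
  exact hfg x

namespace IsCalculusValue

theorem unique
    (hfalg : ∀ a b z : A, a ⊓ b = 0 → 0 ≤ z → (z * a) ⊓ b = 0 ∧ (a * z) ⊓ b = 0)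
    (harch : ∀ a b : A, 0 ≤ a → 0 ≤ b → (∀ k : ℕ, k • a ≤ b) → a = 0)
    (hz : IsCalculusValue a f z) (hw : IsCalculusValue a f w) : z = w := by
  obtain ⟨h, c, hh, h0, hz⟩ := hz
  obtain ⟨l, v, hl, l0, hw⟩ := hw
  have hc := hh.nonneg hfalg harch h0
  have hv := hl.nonneg hfalg harch l0
  have hzw : |z - w| = 0 := by
    refine eq_zero_of_forall_le_smul harch (y := (2 : ℝ) • (c + v)) (abs_nonneg _)
      (smul_nonneg zero_le_two (add_nonneg hc hv)) fun ε hε => ?_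
    obtain ⟨g, b, hg, hfg, hzb⟩ := hz ε hε
    obtain ⟨k, d, hk, hfk, hwd⟩ := hw ε hε
    have hbd := hg.abs_sub_le hfalg harch hk hh hl hfg hfk
    calc |z - w| = |(z - b) + (b - d) + -(w - d)| := by congr 1; abel
      _ ≤ |(z - b) + (b - d)| + |-(w - d)| := abs_add_le _ _
      _ ≤ |z - b| + |b - d| + |w - d| := by
        rw [abs_neg]
        exact add_le_add_left (abs_add_le _ _) _
      _ ≤ ε • c + (ε • c + ε • v) + ε • v := add_le_add (add_le_add hzb hbd) hwd
      _ = ε • (2 : ℝ) • (c + v) := by module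
  have h1 := le_abs_self (z - w)
  have h2 := neg_le_abs (z - w)
  rw [hzw] at h1 h2
  exact le_antisymm (sub_nonpos.1 h1) (sub_nonneg.1 (neg_nonpos.1 h2))

theorem add (hf : IsCalculusValue a f z) (hg : IsCalculusValue a g w) :
    IsCalculusValue a (f + g) (z + w) := by
  obtain ⟨h, c, hh, h0, hz⟩ := hf
  obtain ⟨l, v, hl, l0, hw⟩ := hg
  refine ⟨_, _, hh.add hl, fun x => add_nonneg (h0 x) (l0 x), fun ε hε => ?_⟩
  obtain ⟨g', b, hg', hfg, hzb⟩ := hz ε hε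
  obtain ⟨k, d, hk, hfk, hwd⟩ := hw ε hε
  refine ⟨_, _, hg'.add hk, fun x => ?_, ?_⟩
  · simp only [Pi.add_apply]
    rw [add_sub_add_comm, mul_add]
    exact (abs_add_le _ _).trans (add_le_add (hfg x) (hfk x))
  · rw [add_sub_add_comm, smul_add]
    exact (abs_add_le _ _).trans (add_le_add hzb hwd)

theorem smul (r : ℝ) (hf : IsCalculusValue a f z) : IsCalculusValue a (r • f) (r • z) := by
  obtain ⟨h, c, hh, h0, hz⟩ := hf
  refine ⟨_, _, hh.smul |r|, fun x => mul_nonneg (abs_nonneg r) (h0 x), fun ε hε => ?_⟩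
  obtain ⟨g', b, hg', hfg, hzb⟩ := hz ε hε
  refine ⟨_, _, hg'.smul r, fun x => ?_, ?_⟩
  · simp only [Pi.smul_apply, smul_eq_mul]
    rw [← mul_sub, abs_mul, mul_left_comm]
    exact mul_le_mul_of_nonneg_left (hfg x) (abs_nonneg r)
  · rw [← smul_sub, smul_comm]
    exact (abs_smul_le_smul_abs _ _).trans (smul_le_smul_of_nonneg_left hzb (abs_nonneg r))

theorem sup (hf : IsCalculusValue a f z) (hg : IsCalculusValue a g w) :
    IsCalculusValue a (f ⊔ g) (z ⊔ w) := by
  obtain ⟨h, c, hh, h0, hz⟩ := hf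
  obtain ⟨l, v, hl, l0, hw⟩ := hg
  refine ⟨_, _, hh.add hl, fun x => add_nonneg (h0 x) (l0 x), fun ε hε => ?_⟩
  obtain ⟨g', b, hg', hfg, hzb⟩ := hz ε hε
  obtain ⟨k, d, hk, hfk, hwd⟩ := hw ε hε
  refine ⟨_, _, hg'.sup hk, fun x => ?_, ?_⟩
  · rw [Pi.add_apply, mul_add]
    exact (abs_sup_sub_sup_le _ _ _ _).trans (add_le_add (hfg x) (hfk x))
  · rw [smul_add]
    exact (abs_sup_sub_sup_le _ _ _ _).trans (add_le_add hzb hwd)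

theorem exists_abs_le (hf : IsCalculusValue a f z) :
    ∃ p u, GeneratedGraph a p u ∧ (∀ x, |f x| ≤ p x) ∧ |z| ≤ u := by
  obtain ⟨h, c, hh, -, hz⟩ := hf
  obtain ⟨g, b, hg, hfg, hzb⟩ := hz 1 one_pos
  refine ⟨_, _, hg.abs.add hh, fun x => ?_, ?_⟩
  · have := (abs_sub_abs_le_abs_sub (f x) (g x)).trans (hfg x)
    rw [Pi.add_apply, Pi.abs_apply]
    linarith
  · calc |z| = |b + (z - b)| := by congr 1; abel
      _ ≤ |b| + |z - b| := abs_add_le _ _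
      _ ≤ |b| + c := add_le_add_right (hzb.trans_eq (one_smul ℝ c)) _

theorem mul
    (hfalg : ∀ a b z : A, a ⊓ b = 0 → 0 ≤ z → (z * a) ⊓ b = 0 ∧ (a * z) ⊓ b = 0)
    (harch : ∀ a b : A, 0 ≤ a → 0 ≤ b → (∀ k : ℕ, k • a ≤ b) → a = 0)
    (hf : IsCalculusValue a f z) (hg : IsCalculusValue a g w) :
    IsCalculusValue a (f * g) (z * w) := by
  obtain ⟨p, p', hp, hfp, hzp⟩ := hf.exists_abs_le
  obtain ⟨q, q', hq, hgq, hwq⟩ := hg.exists_abs_le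
  obtain ⟨h, c, hh, h0, hz⟩ := hf
  obtain ⟨l, v, hl, l0, hw⟩ := hg
  have hv := hl.nonneg hfalg harch l0
  have hmaj : ∀ x, 0 ≤ (p * l + h * (q + l)) x := fun x =>
    add_nonneg (mul_nonneg ((abs_nonneg _).trans (hfp x)) (l0 x))
      (mul_nonneg (h0 x) (add_nonneg ((abs_nonneg _).trans (hgq x)) (l0 x)))
  have hmajG := (hp.mul hl).add (hh.mul (hq.add hl))
  refine ⟨_, _, hmajG, hmaj, fun ε hε => ?_⟩
  have hδ : 0 < min ε 1 := lt_min hε one_pos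
  obtain ⟨g', b, hg', hfg, hzb⟩ := hz _ hδ
  obtain ⟨k, d, hk, hfk, hwd⟩ := hw _ hδ
  refine ⟨_, _, hg'.mul hk, fun x => ?_, ?_⟩
  · exact (abs_mul_sub_mul_le hδ.le (min_le_right _ _) (hfp x) (hgq x) (l0 x) (hfg x)
      (hfk x)).trans (mul_le_mul_of_nonneg_right (min_le_left _ _) (hmaj x))
  · exact (abs_mul_sub_mul_le hδ.le (min_le_right _ _) hzp hwq hv hzb hwd).trans
      (smul_le_smul_of_nonneg_right (min_le_left _ _) (hmajG.nonneg hfalg harch hmaj))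

end IsCalculusValue

theorem PolyGrowthH.exists_isCalculusValue
    (hfalg : ∀ a b z : A, a ⊓ b = 0 → 0 ≤ z → (z * a) ⊓ b = 0 ∧ (a * z) ⊓ b = 0)
    (harch : ∀ a b : A, 0 ≤ a → 0 ≤ b → (∀ k : ℕ, k • a ≤ b) → a = 0)
    (huc : UniformlyComplete A) (hf : PolyGrowthH n f) (a : Fin n → A) :
    ∃ z, IsCalculusValue a f z := by
  obtain ⟨h, c, hh, h0, happ⟩ := hf.exists_approx a
  have hc := hh.nonneg hfalg harch h0
  have hpos : ∀ k : ℕ, 0 < 1 / ((k : ℝ) + 1) := fun k => Nat.one_div_pos_of_nat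
  choose g b hg hfg using fun k : ℕ => happ _ (hpos k)
  have hsub : ∀ p q : ℕ, |b p - b q| ≤ (1 / ((p : ℝ) + 1) + 1 / ((q : ℝ) + 1)) • c := fun p q => by
    rw [add_smul]
    exact (hg p).abs_sub_le hfalg harch (hg q) hh hh (hfg p) (hfg q)
  have hmem : ∀ k, b k - b 0 ∈ idealSet c := fun k =>
    ⟨_, add_nonneg (hpos k).le (hpos 0).le, hsub k 0⟩
  obtain ⟨x, hx, hlim⟩ := huc c hc (fun k => b k - b 0) hmem fun ε hε => by
    obtain ⟨N, hN⟩ := exists_nat_one_div_lt (half_pos hε)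
    refine ⟨N, fun p q hp hq => ?_⟩
    rw [sub_sub_sub_cancel_right]
    refine (regNorm_le (add_nonneg (hpos p).le (hpos q).le) (hsub p q)).trans_lt ?_
    have hp' := Nat.one_div_le_one_div (α := ℝ) hp
    have hq' := Nat.one_div_le_one_div (α := ℝ) hq
    linarith
  refine ⟨x + b 0, h, c, hh, h0, fun ε hε => ?_⟩
  obtain ⟨N, hN⟩ := exists_nat_one_div_lt hε
  obtain ⟨K, hK⟩ := hlim ε hε
  refine ⟨_, _, hg (max N K), fun y => (hfg _ y).trans ?_, ?_⟩
  · exact mul_le_mul_of_nonneg_right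
      ((Nat.one_div_le_one_div (le_max_left N K)).trans hN.le) (h0 y)
  · have h1 := abs_le_smul_of_regNorm_lt hc (sub_mem_idealSet (hmem _) hx)
      (hK _ (le_max_right N K))
    rw [← abs_neg] at h1
    convert h1 using 2
    abel

/-- A lattice-algebra homomorphism on `PG_n^h` takes on each function the value of the calculus. -/
theorem IsLatAlgHom.isCalculusValue {Ψ : ∀ f : (Fin n → ℝ) → ℝ, PolyGrowthH n f → A}
    (hΨ : IsLatAlgHom (PolyGrowthH n) Ψ)
    (hgen : ∀ (i : Fin n) (hi : PolyGrowthH n fun t => t i), Ψ (fun t => t i) hi = a i)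
    (hf : PolyGrowthH n f) : IsCalculusValue a f (Ψ f hf) := by
  obtain ⟨⟨hadd, hsmul, hsup⟩, hmul⟩ := hΨ
  have hval : ∀ {g z}, GeneratedGraph a g z → ∀ hg, Ψ g hg = z := fun {g z} h => by
    induction h with
    | zero =>
      intro h0
      have h1 : PolyGrowthH n ((0 : ℝ) • (0 : (Fin n → ℝ) → ℝ)) := h0.smul 0
      have h2 := hsmul 0 0 h0 h1
      simpa only [zero_smul] using h2
    | gen i => exact hgen i
    | add h1 h2 ih1 ih2 =>
      intro h
      rw [hadd _ _ h1.polyGrowthH h2.polyGrowthH h, ih1, ih2]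
    | smul c h1 ih =>
      intro h
      rw [hsmul _ _ h1.polyGrowthH h, ih]
    | sup h1 h2 ih1 ih2 =>
      intro h
      rw [hsup _ _ h1.polyGrowthH h2.polyGrowthH h, ih1, ih2]
    | mul h1 h2 ih1 ih2 =>
      intro h
      rw [hmul _ _ h1.polyGrowthH h2.polyGrowthH h, ih1, ih2]
  have hmono : ∀ {g k} (hg : PolyGrowthH n g) (hk : PolyGrowthH n k), g ≤ k → Ψ g hg ≤ Ψ k hk := by
    intro g k hg hk hgk
    have h := hsup g k hg hk (hg.sup hk)
    simp only [sup_eq_right.2 hgk] at h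
    exact sup_eq_right.1 h.symm
  obtain ⟨h, c, hh, h0, happ⟩ := hf.exists_approx a
  refine ⟨h, c, hh, h0, fun ε hε => ?_⟩
  obtain ⟨g, b, hg, hfg⟩ := happ ε hε
  refine ⟨g, b, hg, hfg, abs_le'.2 ⟨?_, ?_⟩⟩
  · have hG := hg.add (hh.smul ε)
    have hle := hmono hf hG.polyGrowthH fun x => by
      have := (abs_le.1 (hfg x)).2
      simp only [Pi.add_apply, Pi.smul_apply, smul_eq_mul]
      linarith
    rw [hval hG] at hle
    exact sub_le_iff_le_add'.2 hle
  · have hG := hg.sub (hh.smul ε)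
    have hle := hmono hG.polyGrowthH hf fun x => by
      have := (abs_le.1 (hfg x)).1
      simp only [Pi.sub_apply, Pi.smul_apply, smul_eq_mul]
      linarith
    rw [hval hG] at hle
    rw [neg_sub]
    exact sub_le_comm.1 hle

end FunctionalCalculus

/-- `PG_n^h` is the free uniformly complete `f`-algebra on `n` generators:
every uniformly complete Archimedean `f`-algebra admits a unique polynomial growth
continuous function calculus without constants at each `n`-tuple. -/
theorem stmt_5 {A : Type*} [Lattice A] [NonUnitalRing A] [Module ℝ A]
    [CovariantClass A A (· + ·) (· ≤ ·)] [IsScalarTower ℝ A A] [SMulCommClass ℝ A A]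
    (hsmulpos : ∀ (c : ℝ) (a : A), 0 ≤ c → 0 ≤ a → 0 ≤ c • a)
    (hmulpos : ∀ a b : A, 0 ≤ a → 0 ≤ b → 0 ≤ a * b)
    (hfalg : ∀ a b z : A, a ⊓ b = 0 → 0 ≤ z → (z * a) ⊓ b = 0 ∧ (a * z) ⊓ b = 0)
    (harch : ∀ a b : A, 0 ≤ a → 0 ≤ b → (∀ k : ℕ, k • a ≤ b) → a = 0)
    (huc : UniformlyComplete A)
    (n : ℕ) (a : Fin n → A) :
    ∃ Ψ : ∀ f : (Fin n → ℝ) → ℝ, PolyGrowthH n f → A,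
      (IsLatAlgHom (PolyGrowthH n) Ψ ∧
        ∀ (i : Fin n) (hi : PolyGrowthH n fun t => t i), Ψ (fun t => t i) hi = a i) ∧
      ∀ Ψ' : ∀ f : (Fin n → ℝ) → ℝ, PolyGrowthH n f → A,
        (IsLatAlgHom (PolyGrowthH n) Ψ' ∧
          ∀ (i : Fin n) (hi : PolyGrowthH n fun t => t i), Ψ' (fun t => t i) hi = a i) →
        ∀ (f : (Fin n → ℝ) → ℝ) (hf : PolyGrowthH n f), Ψ' f hf = Ψ f hf := by
  have : IsOrderedAddMonoid A := { add_le_add_left := fun x y h z => add_le_add_left h z }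
  have : PosSMulMono ℝ A := ⟨fun c hc x y h => by
    have := hsmulpos c (y - x) hc (sub_nonneg.2 h)
    rwa [smul_sub, sub_nonneg] at this⟩
  have : SMulPosMono ℝ A := ⟨fun x hx c d h => by
    have := hsmulpos (d - c) x (sub_nonneg.2 h) hx
    rwa [sub_smul, sub_nonneg] at this⟩
  have : IsOrderedModule ℝ A := {}
  have : PosMulMono A := ⟨fun x hx y z h => by
    have := hmulpos x (z - y) hx (sub_nonneg.2 h)
    rwa [mul_sub, sub_nonneg] at this⟩
  have : MulPosMono A := ⟨fun x hx y z h => by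
    have := hmulpos (z - y) x (sub_nonneg.2 h) hx
    rwa [sub_mul, sub_nonneg] at this⟩
  choose Ψ hΨ using fun f (hf : PolyGrowthH n f) =>
    hf.exists_isCalculusValue hfalg harch huc a
  refine ⟨Ψ, ⟨⟨⟨?_, ?_, ?_⟩, ?_⟩, ?_⟩, ?_⟩
  · exact fun f g hf hg hfg => (hΨ _ hfg).unique hfalg harch ((hΨ f hf).add (hΨ g hg))
  · exact fun c f hf hcf => (hΨ _ hcf).unique hfalg harch ((hΨ f hf).smul c)
  · exact fun f g hf hg hfg => (hΨ _ hfg).unique hfalg harch ((hΨ f hf).sup (hΨ g hg))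
  · exact fun f g hf hg hfg =>
      (hΨ _ hfg).unique hfalg harch ((hΨ f hf).mul hfalg harch (hΨ g hg))
  · exact fun i hi => (hΨ _ hi).unique hfalg harch (GeneratedGraph.gen i).isCalculusValue
  · exact fun Ψ' hΨ' f hf => (hΨ'.1.isCalculusValue hΨ'.2 hf).unique hfalg harch (hΨ f hf)
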